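/- Let n ≥ 1, let X ⊂ ℝⁿ be open and bounded, let Y ⊂ ℝⁿ be open, bounded and convex, let a₀ ∈ ℝ and y₀ ∈ Y, and let q > 2. Let γ : X → ℝ be Lipschitz continuous with γ(x) ≥ λ for all x ∈ X, for some constant λ > 0. Suppose u belongs to the admissible class U₀ and minimizes the Rochet–Choné functional with q-power cost L(v) = ∫_X ( |∇v(x)|^q/q − x·∇v(x) + v(x) ) γ(x) dx over U₀. Then u ∈ C^{1,1/(q−1)}_loc(X); that is, u is differentiable on X and for every compact subset K ⊂ X the gradient ∇u is Hölder continuous on K with exponent 1/(q−1). -/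

import Mathlib

open MeasureTheory RealInnerProductSpace

/-- The subdifferential of `v` at `x`, relative to the set `X`:
the set of `p` with `v z ≥ v x + ⟪p, z - x⟫` for all `z ∈ X`. -/
def subgrad {n : ℕ} (X : Set (EuclideanSpace ℝ (Fin n)))
    (v : EuclideanSpace ℝ (Fin n) → ℝ) (x : EuclideanSpace ℝ (Fin n)) :
    Set (EuclideanSpace ℝ (Fin n)) :=
  {p | ∀ z ∈ X, v x + ⟪p, z - x⟫ ≤ v z}

/-- The admissible class `U₀`: convex functions on `X` whose subdifferential lies in the
closure of `Y` and which dominate the affine function `x ↦ a₀ + x·y₀`. -/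
def admissible {n : ℕ} (X Y : Set (EuclideanSpace ℝ (Fin n))) (a₀ : ℝ)
    (y₀ : EuclideanSpace ℝ (Fin n)) (v : EuclideanSpace ℝ (Fin n) → ℝ) : Prop :=
  ConvexOn ℝ X v ∧ (∀ x ∈ X, subgrad X v x ⊆ closure Y) ∧
    ∀ x ∈ X, a₀ + ⟪x, y₀⟫ ≤ v x

/-- The Rochet–Choné functional with `q`-power cost,
`L(v) = ∫_X (|∇v|^q/q - x·∇v + v) γ dx`, where `∇v` is the (a.e. defined) gradient. -/
noncomputable def rochetChone {n : ℕ} (X : Set (EuclideanSpace ℝ (Fin n)))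
    (γ : EuclideanSpace ℝ (Fin n) → ℝ) (q : ℝ)
    (v : EuclideanSpace ℝ (Fin n) → ℝ) : ℝ :=
  ∫ x in X, (‖gradient v x‖ ^ q / q - ⟪x, gradient v x⟫ + v x) * γ x

/-- A convex function on an open set has a subgradient at each point. -/
theorem subgrad_nonempty {n : ℕ} {X : Set (EuclideanSpace ℝ (Fin n))} (hXo : IsOpen X)
    {v : EuclideanSpace ℝ (Fin n) → ℝ} (hv : ConvexOn ℝ X v)
    {x : EuclideanSpace ℝ (Fin n)} (hx : x ∈ X) : (subgrad X v x).Nonempty := by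
  have hcont : ContinuousOn v X := hv.continuousOn hXo
  have hopen : IsOpen {p : EuclideanSpace ℝ (Fin n) × ℝ | p.1 ∈ X ∧ v p.1 < p.2} := by
    have h1 : IsOpen (X ×ˢ (Set.univ : Set ℝ)) := hXo.prod isOpen_univ
    have h2 : ContinuousOn (fun p : EuclideanSpace ℝ (Fin n) × ℝ => p.2 - v p.1)
        (X ×ˢ (Set.univ : Set ℝ)) :=
      continuousOn_snd.sub (hcont.comp continuousOn_fst fun p hp => hp.1)
    convert h2.isOpen_inter_preimage h1 (isOpen_Ioi (a := 0)) using 1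
    ext p
    simp
  obtain ⟨f, hf⟩ := geometric_hahn_banach_open_point hv.convex_strict_epigraph hopen
    (x := (x, v x)) (by simp)
  set a : ℝ := f (0, 1) with ha
  have hsplit : ∀ z : EuclideanSpace ℝ (Fin n), ∀ t : ℝ, f (z, t) = f (z, 0) + t * a := by
    intro z t
    have : ((z, t) : EuclideanSpace ℝ (Fin n) × ℝ) = (z, 0) + t • (0, 1) := by simp
    rw [this, map_add, map_smul, smul_eq_mul]
  have ha_neg : a < 0 := by
    have := hf (x, v x + 1) ⟨hx, by simp⟩
    rw [hsplit, hsplit x (v x)] at this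
    linarith
  set g : EuclideanSpace ℝ (Fin n) →L[ℝ] ℝ :=
    f.comp (ContinuousLinearMap.inl ℝ (EuclideanSpace ℝ (Fin n)) ℝ) with hg
  have hgf : ∀ z, g z = f (z, 0) := fun z => by simp [hg]
  refine ⟨(InnerProductSpace.toDual ℝ _).symm ((-a)⁻¹ • g), fun z hz => ?_⟩
  rw [InnerProductSpace.toDual_symm_apply]
  have key : f (z, 0) + v z * a ≤ f (x, 0) + v x * a := by
    refine le_of_forall_pos_lt_add fun ε hε => ?_
    have := hf (z, v z + ε / (-a)) ⟨hz, by
      simpa using div_pos hε (neg_pos.2 ha_neg)⟩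
    rw [hsplit, hsplit x (v x)] at this
    have h3 : ε / (-a) * a = -ε := by
      have := ha_neg.ne
      field_simp
    nlinarith
  have hgz : g (z - x) ≤ (v z - v x) * (-a) := by
    rw [map_sub, hgf, hgf]
    linarith
  have : (-a)⁻¹ * g (z - x) ≤ v z - v x := by
    rw [inv_mul_le_iff₀ (neg_pos.2 ha_neg)]
    linarith
  simp only [FunLike.coe_smul, Pi.smul_apply, smul_eq_mul]
  linarith

/-- A convex function with subgradients of norm at most `R` is `R`-Lipschitz. -/
theorem lipschitzOnWith_of_subgrad {n : ℕ} {X : Set (EuclideanSpace ℝ (Fin n))} (hXo : IsOpen X)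
    {v : EuclideanSpace ℝ (Fin n) → ℝ} (hv : ConvexOn ℝ X v) {R : NNReal}
    (hR : ∀ x ∈ X, ∀ p ∈ subgrad X v x, ‖p‖ ≤ R) : LipschitzOnWith R v X := by
  refine LipschitzOnWith.of_le_add_mul R fun x hx y hy => ?_
  obtain ⟨p, hp⟩ := subgrad_nonempty hXo hv hx
  have h1 := hp y hy
  have h2 : |⟪p, y - x⟫| ≤ R * dist x y := by
    refine (abs_real_inner_le_norm _ _).trans ?_
    rw [dist_eq_norm, norm_sub_rev x y]
    exact mul_le_mul_of_nonneg_right (hR x hx p hp) (norm_nonneg _)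
  linarith [neg_abs_le ⟪p, y - x⟫]

/-- Taking the maximum with an affine function of admissible slope preserves admissibility. -/
theorem admissible_max_affine {n : ℕ} {X Y : Set (EuclideanSpace ℝ (Fin n))} (hXo : IsOpen X)
    (hYc : Convex ℝ Y) {a₀ : ℝ} {y₀ : EuclideanSpace ℝ (Fin n)}
    {u : EuclideanSpace ℝ (Fin n) → ℝ} (hu : admissible X Y a₀ y₀ u)
    {P : EuclideanSpace ℝ (Fin n)} (hP : P ∈ closure Y) (c : ℝ) :
    admissible X Y a₀ y₀ (fun x => max (u x) (⟪P, x⟫ + c)) := by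
  obtain ⟨hconv, hsub, hlow⟩ := hu
  refine ⟨hconv.sup ?_, ?_, fun x hx => (hlow x hx).trans (le_max_left _ _)⟩
  · exact (((innerₗ _ P).convexOn hconv.1).add_const c)
  intro x hx g hg
  by_contra hgY
  obtain ⟨f, σ, hfY, hσ⟩ := geometric_hahn_banach_closed_point hYc.closure isClosed_closure hgY
  set e := (InnerProductSpace.toDual ℝ _).symm f with he
  have hfe : ∀ z, f z = ⟪e, z⟫ := fun z => by
    rw [he, InnerProductSpace.toDual_symm_apply]
  have hcont : Filter.Tendsto (fun s : ℝ => x + s • e) (nhdsWithin 0 (Set.Ioi 0)) (nhds x) := by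
    have : ContinuousAt (fun s : ℝ => x + s • e) 0 := by fun_prop
    have h2 := this.tendsto
    simp only [zero_smul, add_zero] at h2
    exact h2.mono_left nhdsWithin_le_nhds
  obtain ⟨s, hsX, hs⟩ := ((hcont.eventually (hXo.mem_nhds hx)).and self_mem_nhdsWithin).exists
  replace hs : 0 < s := hs
  obtain ⟨p, hp⟩ := subgrad_nonempty hXo hconv hsX
  have hpσ : ⟪p, e⟫ < σ := by
    rw [real_inner_comm, ← hfe]; exact hfY p (hsub _ hsX hp)
  have hPσ : ⟪P, e⟫ < σ := by
    rw [real_inner_comm, ← hfe]; exact hfY P hP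
  have hgσ : σ < ⟪g, e⟫ := by
    rw [real_inner_comm, ← hfe]; exact hσ
  have h1 := hp x hx
  have h2 := hg _ hsX
  simp only [sub_add_cancel_left, add_sub_cancel_left, inner_neg_right, inner_smul_right,
    inner_add_right] at h1 h2
  have hlt : max (u (x + s • e)) (⟪P, x⟫ + s * ⟪P, e⟫ + c) < max (u x) (⟪P, x⟫ + c) + s * σ := by
    refine max_lt ?_ ?_
    · nlinarith [le_max_left (u x) (⟪P, x⟫ + c)]
    · nlinarith [le_max_right (u x) (⟪P, x⟫ + c)]
  nlinarith

/-- The gradient inequality for `z ↦ ‖z‖ ^ q / q`. -/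
theorem norm_rpow_gradient_inequality {F : Type*} [NormedAddCommGroup F] [InnerProductSpace ℝ F]
    {q : ℝ} (hq : 2 < q) (a b : F) :
    ‖a‖ ^ q / q + ⟪‖a‖ ^ (q - 2) • a, b - a⟫ ≤ ‖b‖ ^ q / q := by
  have hq1 : (q / (q - 1)).HolderConjugate q :=
    (Real.HolderConjugate.conjExponent (by linarith : 1 < q)).symm
  have hy := Real.young_inequality_of_nonneg (Real.rpow_nonneg (norm_nonneg a) (q - 1))
    (norm_nonneg b) hq1
  have hq0 : q - 1 ≠ 0 := by linarith
  rw [← Real.rpow_mul (norm_nonneg a), mul_div_cancel₀ _ hq0] at hy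
  have h1 : ‖a‖ ^ (q - 2) * ‖a‖ = ‖a‖ ^ (q - 1) := by
    rw [← Real.rpow_add_one' (norm_nonneg a) (by linarith)]; congr 1; ring
  have h2 : ‖a‖ ^ (q - 2) * ‖a‖ ^ 2 = ‖a‖ ^ q := by
    rw [← Real.rpow_natCast, ← Real.rpow_add' (norm_nonneg a) (by norm_num; linarith)]
    congr 1; norm_num
  rw [inner_smul_left, inner_sub_right, real_inner_self_eq_norm_sq]
  simp only [conj_trivial]
  have h3 : ‖a‖ ^ (q - 2) * ⟪a, b⟫ ≤ ‖a‖ ^ (q - 1) * ‖b‖ := by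
    rw [← h1, mul_assoc]
    exact mul_le_mul_of_nonneg_left (real_inner_le_norm a b) (Real.rpow_nonneg (norm_nonneg a) _)
  have h4 : ‖a‖ ^ q / (q / (q - 1)) = ‖a‖ ^ q - ‖a‖ ^ q / q := by
    field_simp
  rw [mul_sub, h2]
  linarith

/-- Clarkson's inequality in an inner product space. -/
theorem norm_rpow_clarkson {F : Type*} [NormedAddCommGroup F] [InnerProductSpace ℝ F]
    {q : ℝ} (hq : 2 < q) (a b : F) :
    ‖(1 / 2 : ℝ) • (a + b)‖ ^ q + ‖(1 / 2 : ℝ) • (b - a)‖ ^ q ≤ (‖a‖ ^ q + ‖b‖ ^ q) / 2 := by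
  have hpow : ∀ z : F, ‖z‖ ^ q = (‖z‖ ^ 2) ^ (q / 2) := fun z => by
    rw [← Real.rpow_natCast, ← Real.rpow_mul (norm_nonneg z)]; congr 1; push_cast; ring
  rw [hpow, hpow (_ • (b - a)), hpow a, hpow b]
  refine (Real.add_rpow_le_rpow_add (sq_nonneg _) (sq_nonneg _) (by linarith)).trans ?_
  have hpar : ‖(1 / 2 : ℝ) • (a + b)‖ ^ 2 + ‖(1 / 2 : ℝ) • (b - a)‖ ^ 2
      = (1 / 2 : ℝ) • ‖a‖ ^ 2 + (1 / 2 : ℝ) • ‖b‖ ^ 2 := by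
    have := parallelogram_law_with_norm ℝ b a
    rw [norm_smul, norm_smul, add_comm a b]
    simp only [Real.norm_eq_abs, smul_eq_mul, mul_pow, sq_abs]
    nlinarith
  rw [hpar]
  have := (convexOn_rpow (by linarith : 1 ≤ q / 2)).2 (Set.mem_Ici.2 (sq_nonneg ‖a‖))
    (Set.mem_Ici.2 (sq_nonneg ‖b‖)) (by norm_num : (0 : ℝ) ≤ 1 / 2)
    (by norm_num : (0 : ℝ) ≤ 1 / 2) (by norm_num)
  simp only [smul_eq_mul] at this ⊢
  linarith

/-- Uniform convexity of `z ↦ ‖z‖ ^ q / q` of power type `q`. -/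
theorem norm_rpow_uniform_convexity {F : Type*} [NormedAddCommGroup F] [InnerProductSpace ℝ F]
    {q : ℝ} (hq : 2 < q) (a b : F) :
    ‖a‖ ^ q / q + ⟪‖a‖ ^ (q - 2) • a, b - a⟫ + 2 * (1 / 2) ^ q / q * ‖b - a‖ ^ q
      ≤ ‖b‖ ^ q / q := by
  have h1 := norm_rpow_gradient_inequality hq a ((1 / 2 : ℝ) • (a + b))
  have h2 := norm_rpow_clarkson hq a b
  have h3 : (1 / 2 : ℝ) • (a + b) - a = (1 / 2 : ℝ) • (b - a) := by module
  rw [h3, inner_smul_right] at h1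
  rw [norm_smul _ (b - a), Real.mul_rpow (norm_nonneg _) (norm_nonneg _),
    Real.norm_of_nonneg (by norm_num)] at h2
  have hq0 : 0 < q := by linarith
  have h4 := div_le_div_of_nonneg_right h2 hq0.le
  have h5 : (‖(1 / 2 : ℝ) • (a + b)‖ ^ q + (1 / 2) ^ q * ‖b - a‖ ^ q) / q
      = ‖(1 / 2 : ℝ) • (a + b)‖ ^ q / q + (1 / 2) ^ q / q * ‖b - a‖ ^ q := by ring
  have h6 : (‖a‖ ^ q + ‖b‖ ^ q) / 2 / q = (‖a‖ ^ q / q + ‖b‖ ^ q / q) / 2 := by ring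
  have h7 : 2 * (1 / 2) ^ q / q * ‖b - a‖ ^ q = 2 * ((1 / 2) ^ q / q * ‖b - a‖ ^ q) := by ring
  rw [h5, h6] at h4
  rw [h7]
  linarith

/-- A Lipschitz cutoff vanishing off `X` and equal to `1` at distance at least `δ` from `Xᶜ`. -/
noncomputable def boundaryCutoff {n : ℕ} (X : Set (EuclideanSpace ℝ (Fin n))) (δ : ℝ)
    (x : EuclideanSpace ℝ (Fin n)) : ℝ :=
  min 1 (Metric.infDist x Xᶜ / δ)

section Cutoff

variable {n : ℕ} {X : Set (EuclideanSpace ℝ (Fin n))} {δ : ℝ}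

theorem boundaryCutoff_nonneg (hδ : 0 < δ) (x : EuclideanSpace ℝ (Fin n)) :
    0 ≤ boundaryCutoff X δ x :=
  le_min zero_le_one (div_nonneg Metric.infDist_nonneg hδ.le)

theorem boundaryCutoff_le_one (x : EuclideanSpace ℝ (Fin n)) : boundaryCutoff X δ x ≤ 1 :=
  min_le_left _ _

theorem boundaryCutoff_of_notMem {x : EuclideanSpace ℝ (Fin n)} (hx : x ∉ X) :
    boundaryCutoff X δ x = 0 := by
  simp [boundaryCutoff, Metric.infDist_zero_of_mem (Set.mem_compl hx)]

theorem boundaryCutoff_lipschitzWith (hδ : 0 < δ) :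
    LipschitzWith (Real.toNNReal δ⁻¹) (boundaryCutoff X δ) := by
  refine LipschitzWith.const_min ?_ 1
  refine LipschitzWith.of_le_add_mul _ fun x y => ?_
  rw [Real.coe_toNNReal _ (inv_nonneg.2 hδ.le), div_eq_inv_mul, div_eq_inv_mul, ← mul_add]
  exact mul_le_mul_of_nonneg_left Metric.infDist_le_infDist_add_dist (inv_nonneg.2 hδ.le)

theorem boundaryCutoff_eq_one (hδ : 0 < δ) (hX : Xᶜ.Nonempty) {x : EuclideanSpace ℝ (Fin n)}
    (hx : Metric.ball x δ ⊆ X) : boundaryCutoff X δ x = 1 := by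
  refine min_eq_left ?_
  rw [one_le_div hδ, Metric.le_infDist hX]
  intro y hy
  by_contra! h
  exact hy (hx (by rwa [Metric.mem_ball']))

theorem lineDeriv_eq_zero_of_isLocalExtr {f : EuclideanSpace ℝ (Fin n) → ℝ}
    {x : EuclideanSpace ℝ (Fin n)} (h : IsLocalExtr f x) (e : EuclideanSpace ℝ (Fin n)) :
    lineDeriv ℝ f x e = 0 := by
  have hc : Filter.Tendsto (fun t : ℝ => x + t • e) (nhds 0) (nhds x) := by
    have : ContinuousAt (fun t : ℝ => x + t • e) 0 := by fun_prop
    simpa [ContinuousAt] using this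
  refine IsLocalExtr.deriv_eq_zero (f := fun t : ℝ => f (x + t • e)) ?_
  rcases h with h | h
  · left
    simpa [IsLocalMin, IsMinFilter] using hc.eventually h
  · right
    simpa [IsLocalMax, IsMaxFilter] using hc.eventually h

theorem lineDeriv_boundaryCutoff_of_eq_one {x : EuclideanSpace ℝ (Fin n)}
    (hx : boundaryCutoff X δ x = 1) (e : EuclideanSpace ℝ (Fin n)) :
    lineDeriv ℝ (boundaryCutoff X δ) x e = 0 :=
  lineDeriv_eq_zero_of_isLocalExtr
    (Or.inr (Filter.Eventually.of_forall fun y => hx ▸ boundaryCutoff_le_one y)) e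

theorem lineDeriv_boundaryCutoff_of_notMem (hδ : 0 < δ) {x : EuclideanSpace ℝ (Fin n)}
    (hx : x ∉ X) (e : EuclideanSpace ℝ (Fin n)) :
    lineDeriv ℝ (boundaryCutoff X δ) x e = 0 :=
  lineDeriv_eq_zero_of_isLocalExtr (Or.inl (Filter.Eventually.of_forall fun y => by
    rw [boundaryCutoff_of_notMem hx]; exact boundaryCutoff_nonneg hδ y)) e

theorem abs_lineDeriv_boundaryCutoff_le (hδ : 0 < δ) (x : EuclideanSpace ℝ (Fin n))
    {e : EuclideanSpace ℝ (Fin n)} (he : ‖e‖ = 1) :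
    |lineDeriv ℝ (boundaryCutoff X δ) x e| ≤ δ⁻¹ := by
  have := norm_lineDeriv_le_of_lipschitz ℝ (x₀ := x) (v := e)
    (boundaryCutoff_lipschitzWith (X := X) hδ)
  rwa [he, mul_one, Real.coe_toNNReal _ (inv_nonneg.2 hδ.le)] at this

theorem boundaryCutoff_homothety_eq_one (hXc : Convex ℝ X) (hX : Xᶜ.Nonempty)
    {x₀ z : EuclideanSpace ℝ (Fin n)} {d ε : ℝ} (hd : 0 < d) (hball : Metric.ball x₀ d ⊆ X)
    (hε : 0 < ε) (hε1 : ε ≤ 1) (hz : z ∈ X) :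
    boundaryCutoff X (ε * d) (AffineMap.homothety x₀ (1 - ε) z) = 1 := by
  refine boundaryCutoff_eq_one (mul_pos hε hd) hX fun y hy => ?_
  set x' := AffineMap.homothety x₀ (1 - ε) z with hx'
  have h1 : x₀ + ε⁻¹ • (y - x') ∈ X := by
    refine hball ?_
    rw [mem_ball_iff_norm, add_sub_cancel_left, norm_smul, norm_inv, Real.norm_of_nonneg hε.le,
      inv_mul_lt_iff₀ hε]
    rwa [mem_ball_iff_norm] at hy
  have h2 := hXc hz h1 (sub_nonneg.2 hε1) hε.le (by ring)
  convert h2 using 1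
  rw [smul_add, smul_inv_smul₀ hε.ne', hx', AffineMap.homothety_apply, vsub_eq_sub, vadd_eq_add]
  module

/-- The part of a convex set where the cutoff differs from `1` has small volume. -/
theorem volume_boundaryCutoff_ne_one_le (hXc : Convex ℝ X) (hX : Xᶜ.Nonempty)
    {S : Set (EuclideanSpace ℝ (Fin n))} (hSX : S ⊆ X) (hSc : Convex ℝ S) (hSo : IsOpen S)
    (hSfin : volume S ≠ ⊤)
    {x₀ : EuclideanSpace ℝ (Fin n)} (hx₀ : x₀ ∈ S) {d ε : ℝ} (hd : 0 < d)
    (hball : Metric.ball x₀ d ⊆ X) (hε : 0 < ε) (hε1 : ε ≤ 1) :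
    volume.real {x ∈ S | boundaryCutoff X (ε * d) x ≠ 1} ≤ n * ε * volume.real S := by
  have hcont : Continuous (boundaryCutoff X (ε * d)) :=
    (boundaryCutoff_lipschitzWith (mul_pos hε hd)).continuous
  set T := {x ∈ S | boundaryCutoff X (ε * d) x = 1} with hT
  have hTm : MeasurableSet T :=
    hSo.measurableSet.inter (hcont.measurable (measurableSet_singleton 1))
  have hST : {x ∈ S | boundaryCutoff X (ε * d) x ≠ 1} = S \ T := by
    ext x; simp only [hT, Set.mem_ofPred, Set.mem_sdiff]; tauto
  have hTS : T ⊆ S := fun x hx => hx.1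
  have himage : AffineMap.homothety x₀ (1 - ε) '' S ⊆ T := by
    rintro _ ⟨z, hz, rfl⟩
    refine ⟨?_, boundaryCutoff_homothety_eq_one hXc hX hd hball hε hε1 (hSX hz)⟩
    have := hSc hz hx₀ (sub_nonneg.2 hε1) hε.le (by ring)
    convert this using 1
    rw [AffineMap.homothety_apply, vsub_eq_sub, vadd_eq_add]
    module
  have hvol : (1 - ε) ^ n * volume.real S ≤ volume.real T := by
    have h := measureReal_mono himage (measure_ne_top_of_subset hTS hSfin)
    rwa [Measure.real, Measure.addHaar_image_homothety, ENNReal.toReal_mul,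
      ENNReal.toReal_ofReal (abs_nonneg _), finrank_euclideanSpace_fin,
      abs_of_nonneg (pow_nonneg (sub_nonneg.2 hε1) n)] at h
  have hbern : 1 - n * ε ≤ (1 - ε) ^ n := by
    have := one_add_mul_le_pow (a := -ε) (by linarith) n
    rw [← sub_eq_add_neg] at this
    linarith
  rw [hST, measureReal_sdiff hTS hTm hSfin]
  nlinarith [measureReal_nonneg (μ := volume) (s := S)]

theorem lipschitzWith_mul_of_bounded {f g : EuclideanSpace ℝ (Fin n) → ℝ} {Cf Cg : NNReal}
    {Mf Mg : NNReal} (hf : LipschitzWith Cf f) (hg : LipschitzWith Cg g) (hMf : ∀ x, |f x| ≤ Mf)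
    (hMg : ∀ x, |g x| ≤ Mg) : LipschitzWith (Mf * Cg + Mg * Cf) (fun x => f x * g x) := by
  refine LipschitzWith.of_dist_le_mul fun x y => ?_
  have h1 := hf.dist_le_mul x y
  have h2 := hg.dist_le_mul x y
  rw [Real.dist_eq] at h1 h2 ⊢
  have : f x * g x - f y * g y = f x * (g x - g y) + g y * (f x - f y) := by ring
  rw [this]
  refine (abs_add_le _ _).trans ?_
  rw [abs_mul, abs_mul]
  push_cast
  have h3 := mul_le_mul (hMf x) h2 (abs_nonneg _) Mf.2
  have h4 := mul_le_mul (hMg y) h1 (abs_nonneg _) Mg.2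
  linarith

/-- Integration by parts in `X` against a Lipschitz function times the cutoff. -/
theorem setIntegral_lineDeriv_mul_boundaryCutoff (hXb : Bornology.IsBounded X)
    {w G : EuclideanSpace ℝ (Fin n) → ℝ} {Cw CG M : NNReal} (hw : LipschitzWith Cw w)
    (hG : LipschitzWith CG G) (hM : ∀ x, |G x| ≤ M) (hδ : 0 < δ)
    (e : EuclideanSpace ℝ (Fin n)) :
    ∫ x in X, lineDeriv ℝ w x e * (boundaryCutoff X δ x * G x) =
      -∫ x in X, w x * (boundaryCutoff X δ x * lineDeriv ℝ G x e
        + G x * lineDeriv ℝ (boundaryCutoff X δ) x e) := by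
  have hη := boundaryCutoff_lipschitzWith (X := X) hδ
  have hprod : LipschitzWith _ (fun x => boundaryCutoff X δ x * G x) :=
    lipschitzWith_mul_of_bounded (Mf := 1) hη hG (fun x => by
      rw [abs_of_nonneg (boundaryCutoff_nonneg hδ x)]; exact boundaryCutoff_le_one x) hM
  have hsupp : HasCompactSupport (fun x => boundaryCutoff X δ x * G x) := by
    refine HasCompactSupport.of_support_subset_isCompact hXb.isCompact_closure ?_
    intro x hx
    by_contra hxX
    exact hx (by simp [boundaryCutoff_of_notMem fun h => hxX (subset_closure h)])
  have hibp := hw.integral_lineDeriv_mul_eq (μ := volume) hprod hsupp e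
  rw [setIntegral_eq_integral_of_forall_compl_eq_zero, hibp,
    setIntegral_eq_integral_of_forall_compl_eq_zero, ← integral_neg]
  · refine integral_congr_ae ?_
    filter_upwards [hη.ae_lineDifferentiableAt (μ := volume) e,
      hG.ae_lineDifferentiableAt (μ := volume) e] with x h1 h2
    have h3 := h1.hasLineDerivAt
    have h4 := h2.hasLineDerivAt
    have h5 : HasLineDerivAt ℝ (fun x => boundaryCutoff X δ x * G x)
        (lineDeriv ℝ (boundaryCutoff X δ) x e * G x
          + boundaryCutoff X δ x * lineDeriv ℝ G x e) x e := by
      have := HasDerivAt.mul h3 h4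
      simp only [zero_smul, add_zero] at this
      exact this
    simp only [lineDeriv_neg, h5.lineDeriv]
    ring
  · intro x hx
    simp [boundaryCutoff_of_notMem hx, lineDeriv_boundaryCutoff_of_notMem hδ hx]
  · intro x hx
    simp [boundaryCutoff_of_notMem hx]

end Cutoff

section Section

variable {n : ℕ} {X S : Set (EuclideanSpace ℝ (Fin n))}
  {w G : EuclideanSpace ℝ (Fin n) → ℝ} {Cw CG M : NNReal}

theorem lineDeriv_eq_zero_of_nonneg_of_eq_zero (hw0 : ∀ x, 0 ≤ w x)
    {x : EuclideanSpace ℝ (Fin n)} (hx : w x = 0) (e : EuclideanSpace ℝ (Fin n)) :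
    lineDeriv ℝ w x e = 0 :=
  lineDeriv_eq_zero_of_isLocalExtr
    (Or.inl (Filter.Eventually.of_forall fun y => hx ▸ hw0 y)) e

/-- Integration by parts in `X` for a nonnegative function vanishing on `X \ S`. -/
theorem setIntegral_lineDeriv_mul_boundaryCutoff_of_subset (hXo : IsOpen X)
    (hXb : Bornology.IsBounded X) (hSX : S ⊆ X) (hw : LipschitzWith Cw w) (hw0 : ∀ x, 0 ≤ w x)
    (hwS : ∀ x ∈ X \ S, w x = 0) (hG : LipschitzWith CG G) (hM : ∀ x, |G x| ≤ M)
    {δ : ℝ} (hδ : 0 < δ) (e : EuclideanSpace ℝ (Fin n)) :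
    ∫ x in S, lineDeriv ℝ w x e * (boundaryCutoff X δ x * G x) =
      -∫ x in S, w x * (boundaryCutoff X δ x * lineDeriv ℝ G x e
        + G x * lineDeriv ℝ (boundaryCutoff X δ) x e) := by
  have h := setIntegral_lineDeriv_mul_boundaryCutoff hXb hw hG hM hδ e
  rwa [setIntegral_eq_of_subset_of_forall_sdiff_eq_zero hXo.measurableSet hSX,
    setIntegral_eq_of_subset_of_forall_sdiff_eq_zero hXo.measurableSet hSX] at h
  · intro x hx
    rw [hwS x hx, zero_mul]
  · intro x hx
    rw [lineDeriv_eq_zero_of_nonneg_of_eq_zero hw0 (hwS x hx), zero_mul]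

theorem abs_setIntegral_lineDeriv_mul_boundaryCutoff_le (hXo : IsOpen X)
    (hXb : Bornology.IsBounded X) (hXc : Convex ℝ X) (hX : Xᶜ.Nonempty) (hSX : S ⊆ X)
    (hSc : Convex ℝ S) (hSo : IsOpen S)
    (hw : LipschitzWith Cw w) (hw0 : ∀ x, 0 ≤ w x)
    (hwS : ∀ x ∈ X \ S, w x = 0) {H : ℝ} (hH : ∀ x ∈ S, w x ≤ H) (hG : LipschitzWith CG G)
    (hM : ∀ x, |G x| ≤ M) {x₀ : EuclideanSpace ℝ (Fin n)} (hx₀ : x₀ ∈ S) {d ε : ℝ} (hd : 0 < d)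
    (hball : Metric.ball x₀ d ⊆ X) (hε : 0 < ε) (hε1 : ε ≤ 1)
    {e : EuclideanSpace ℝ (Fin n)} (he : ‖e‖ = 1) :
    |∫ x in S, lineDeriv ℝ w x e * (boundaryCutoff X (ε * d) x * G x)|
      ≤ H * (CG + n * M / d) * volume.real S := by
  have hδ : 0 < ε * d := mul_pos hε hd
  have hSfin : volume S ≠ ⊤ := (hXb.subset hSX).measure_lt_top.ne
  have hH0 : 0 ≤ H := (hw0 x₀).trans (hH x₀ hx₀)
  rw [setIntegral_lineDeriv_mul_boundaryCutoff_of_subset hXo hXb hSX hw hw0 hwS hG hM hδ e,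
    abs_neg]
  set B := {x | boundaryCutoff X (ε * d) x ≠ 1} with hB
  have hBm : MeasurableSet B :=
    ((boundaryCutoff_lipschitzWith hδ).continuous.measurable (measurableSet_singleton 1)).compl
  have hconst (c : ℝ) : Integrable (fun _ => c) (volume.restrict S) := integrableOn_const hSfin
  have hint : IntegrableOn (fun x => H * CG + B.indicator (fun _ => H * (M * (ε * d)⁻¹)) x) S :=
    (hconst _).add ((hconst _).indicator hBm)
  calc |∫ x in S, w x * (boundaryCutoff X (ε * d) x * lineDeriv ℝ G x e
        + G x * lineDeriv ℝ (boundaryCutoff X (ε * d)) x e)|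
      ≤ ∫ x in S, (H * CG + B.indicator (fun _ => H * (M * (ε * d)⁻¹)) x) := by
        rw [← Real.norm_eq_abs]
        refine norm_integral_le_of_norm_le hint ?_
        filter_upwards [ae_restrict_mem hSo.measurableSet] with x hx
        have h1 : |lineDeriv ℝ G x e| ≤ CG := by
          simpa [he] using norm_lineDeriv_le_of_lipschitz ℝ (x₀ := x) (v := e) hG
        have h2 : |boundaryCutoff X (ε * d) x * lineDeriv ℝ G x e| ≤ CG := by
          rw [abs_mul, abs_of_nonneg (boundaryCutoff_nonneg hδ x)]
          calc _ ≤ 1 * (CG : ℝ) :=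
            mul_le_mul (boundaryCutoff_le_one x) h1 (abs_nonneg _) zero_le_one
            _ = CG := one_mul _
        have h3 : |G x * lineDeriv ℝ (boundaryCutoff X (ε * d)) x e|
            ≤ B.indicator (fun _ => M * (ε * d)⁻¹) x := by
          by_cases hxB : x ∈ B
          · rw [Set.indicator_of_mem hxB, abs_mul]
            exact mul_le_mul (hM x) (abs_lineDeriv_boundaryCutoff_le hδ x he) (abs_nonneg _) M.2
          · rw [Set.indicator_of_notMem hxB, lineDeriv_boundaryCutoff_of_eq_one (not_not.1 hxB)]
            simp
        rw [Set.indicator_const_mul (f := fun _ => (M : ℝ) * (ε * d)⁻¹), ← mul_add,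
          Real.norm_eq_abs, abs_mul, abs_of_nonneg (hw0 x)]
        exact mul_le_mul (hH x hx) ((abs_add_le _ _).trans (add_le_add h2 h3)) (abs_nonneg _) hH0
    _ = H * CG * volume.real S + H * (M * (ε * d)⁻¹) * volume.real (S ∩ B) := by
        rw [integral_add (hconst _) ((hconst _).indicator hBm),
          setIntegral_indicator hBm, setIntegral_const, setIntegral_const, smul_eq_mul, smul_eq_mul]
        ring
    _ ≤ H * CG * volume.real S + H * (M * (ε * d)⁻¹) * (n * ε * volume.real S) := by
        gcongr
        exact volume_boundaryCutoff_ne_one_le hXc hX hSX hSc hSo hSfin hx₀ hd hball hε hε1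
    _ = H * (CG + n * M / d) * volume.real S := by
        field_simp

/-- The integral of a directional derivative over `S` against a bounded Lipschitz weight is
controlled by the volume of `S`, uniformly in how much of `S` lies along the boundary of `X`. -/
theorem abs_setIntegral_lineDeriv_mul_le (hXo : IsOpen X)
    (hXb : Bornology.IsBounded X) (hXc : Convex ℝ X) (hX : Xᶜ.Nonempty) (hSX : S ⊆ X)
    (hSc : Convex ℝ S) (hSo : IsOpen S)
    (hw : LipschitzWith Cw w) (hw0 : ∀ x, 0 ≤ w x)
    (hwS : ∀ x ∈ X \ S, w x = 0) {H : ℝ} (hH : ∀ x ∈ S, w x ≤ H) (hG : LipschitzWith CG G)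
    (hM : ∀ x, |G x| ≤ M) {x₀ : EuclideanSpace ℝ (Fin n)} (hx₀ : x₀ ∈ S) {d : ℝ} (hd : 0 < d)
    (hball : Metric.ball x₀ d ⊆ X) {e : EuclideanSpace ℝ (Fin n)} (he : ‖e‖ = 1) :
    |∫ x in S, lineDeriv ℝ w x e * G x| ≤ H * (CG + n * M / d) * volume.real S := by
  have hSfin : volume S ≠ ⊤ := (hXb.subset hSX).measure_lt_top.ne
  have hwe : ∀ x, ‖lineDeriv ℝ w x e‖ ≤ Cw := fun x => by
    simpa [he] using norm_lineDeriv_le_of_lipschitz ℝ (x₀ := x) (v := e) hw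
  have hmw := measurable_lineDeriv (𝕜 := ℝ) hw.continuous (v := e)
  have hbound : ∀ ε ∈ Set.Ioc (0 : ℝ) 1, |∫ x in S, lineDeriv ℝ w x e * G x|
      ≤ H * (CG + n * M / d) * volume.real S + Cw * M * (n * ε * volume.real S) := by
    rintro ε ⟨hε, hε1⟩
    have hδ : 0 < ε * d := mul_pos hε hd
    set η := boundaryCutoff X (ε * d) with hη
    have hηm : Measurable η := (boundaryCutoff_lipschitzWith hδ).continuous.measurable
    have hη01 : ∀ x, 0 ≤ η x ∧ η x ≤ 1 := fun x =>
      ⟨boundaryCutoff_nonneg hδ x, boundaryCutoff_le_one x⟩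
    set B := {x | η x ≠ 1} with hB
    have hBm : MeasurableSet B := (hηm (measurableSet_singleton 1)).compl
    have hint (φ : EuclideanSpace ℝ (Fin n) → ℝ) (hφm : Measurable φ)
        (hφ : ∀ x, 0 ≤ φ x ∧ φ x ≤ 1) :
        Integrable (fun x => lineDeriv ℝ w x e * (φ x * G x)) (volume.restrict S) := by
      refine Measure.integrableOn_of_bounded (M := Cw * (1 * M)) hSfin
        (hmw.mul (hφm.mul hG.continuous.measurable)).aestronglyMeasurable
        (Filter.Eventually.of_forall fun x => ?_)
      rw [norm_mul, norm_mul, Real.norm_of_nonneg (hφ x).1]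
      exact mul_le_mul (hwe x) (mul_le_mul (hφ x).2 (hM x) (abs_nonneg _) zero_le_one)
        (by have := (hφ x).1; positivity) Cw.2
    have h1 := abs_setIntegral_lineDeriv_mul_boundaryCutoff_le hXo hXb hXc hX hSX hSc hSo hw hw0
      hwS hH hG hM hx₀ hd hball hε hε1 he
    have h2 : |∫ x in S, lineDeriv ℝ w x e * ((1 - η x) * G x)|
        ≤ Cw * M * (n * ε * volume.real S) := by
      calc |∫ x in S, lineDeriv ℝ w x e * ((1 - η x) * G x)|
          ≤ ∫ x in S, B.indicator (fun _ => (Cw : ℝ) * M) x := by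
            rw [← Real.norm_eq_abs]
            refine norm_integral_le_of_norm_le ?_ (Filter.Eventually.of_forall fun x => ?_)
            · have : Integrable (fun _ => (Cw : ℝ) * M) (volume.restrict S) :=
                integrableOn_const hSfin
              exact this.indicator hBm
            · by_cases hx : x ∈ B
              · rw [Set.indicator_of_mem hx, norm_mul, norm_mul,
                  Real.norm_of_nonneg (sub_nonneg.2 (hη01 x).2)]
                refine mul_le_mul (hwe x) ?_
                  (mul_nonneg (sub_nonneg.2 (hη01 x).2) (norm_nonneg _)) Cw.2
                calc (1 - η x) * ‖G x‖ ≤ 1 * (M : ℝ) :=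
                      mul_le_mul (by linarith [(hη01 x).1]) (hM x) (abs_nonneg _) zero_le_one
                  _ = M := one_mul _
              · have hx1 : η x = 1 := not_not.1 hx
                simp [hx1, Set.indicator_of_notMem hx]
        _ = Cw * M * volume.real (S ∩ B) := by
            rw [setIntegral_indicator hBm, setIntegral_const, smul_eq_mul, mul_comm]
        _ ≤ Cw * M * (n * ε * volume.real S) := by
            gcongr
            exact volume_boundaryCutoff_ne_one_le hXc hX hSX hSc hSo hSfin hx₀ hd hball hε hε1
    have h3 : ∫ x in S, lineDeriv ℝ w x e * G x = (∫ x in S, lineDeriv ℝ w x e * (η x * G x))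
        + ∫ x in S, lineDeriv ℝ w x e * ((1 - η x) * G x) := by
      rw [← integral_add (hint η hηm hη01) (hint (fun x => 1 - η x) (measurable_const.sub hηm)
        fun x => ⟨by linarith [(hη01 x).2], by linarith [(hη01 x).1]⟩)]
      congr 1
      ext x
      ring
    rw [h3]
    exact (abs_add_le _ _).trans (add_le_add h1 h2)
  have hlim : Filter.Tendsto (fun ε : ℝ => H * (CG + n * M / d) * volume.real S
      + Cw * M * (n * ε * volume.real S)) (nhdsWithin 0 (Set.Ioi 0))
      (nhds (H * (CG + n * M / d) * volume.real S)) := by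
    refine Filter.Tendsto.mono_left ?_ nhdsWithin_le_nhds
    refine Continuous.tendsto' (by fun_prop) _ _ (by simp)
  refine ge_of_tendsto hlim ?_
  filter_upwards [Ioc_mem_nhdsGT zero_lt_one] with ε hε using hbound ε hε

/-- A lower bound for the mean slope of a function which is at least `m` on the half-scale copy of
its section `S`, the section being contained in a slab of half-width `ρ`. -/
theorem le_setIntegral_abs_lineDeriv (hXo : IsOpen X)
    (hXb : Bornology.IsBounded X) (hXc : Convex ℝ X) (hX : Xᶜ.Nonempty) (hSX : S ⊆ X)
    (hSc : Convex ℝ S) (hSo : IsOpen S)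
    (hw : LipschitzWith Cw w) (hw0 : ∀ x, 0 ≤ w x)
    (hwS : ∀ x ∈ X \ S, w x = 0) {H : ℝ} (hH : ∀ x ∈ S, w x ≤ H)
    {x₀ : EuclideanSpace ℝ (Fin n)} (hx₀ : x₀ ∈ S) {d : ℝ} (hd : 0 < d)
    (hball : Metric.ball x₀ d ⊆ X)
    {ξ : EuclideanSpace ℝ (Fin n)} (hξ : ‖ξ‖ = 1) {ρ : NNReal}
    (hslab : ∀ x ∈ S, |⟪ξ, x - x₀⟫| < ρ) {m : ℝ}
    (hwm : ∀ z ∈ S, m ≤ w (AffineMap.homothety x₀ (1 / 2 : ℝ) z)) :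
    (m * (1 / 2) ^ n - 2 * H * ρ / d) * volume.real S
      ≤ ρ * ∫ x in S, |lineDeriv ℝ w x ξ| := by
  have hδ : 0 < 1 / 2 * d := by positivity
  have hSfin : volume S ≠ ⊤ := (hXb.subset hSX).measure_lt_top.ne
  have hH0 : 0 ≤ H := (hw0 x₀).trans (hH x₀ hx₀)
  set η := boundaryCutoff X (1 / 2 * d) with hη
  have hηl : LipschitzWith _ η := boundaryCutoff_lipschitzWith hδ
  set G : EuclideanSpace ℝ (Fin n) → ℝ := fun x => max (-ρ) (min ρ ⟪ξ, x - x₀⟫) with hGdef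
  have hlin : LipschitzWith 1 (fun x : EuclideanSpace ℝ (Fin n) => ⟪ξ, x - x₀⟫) := by
    refine LipschitzWith.of_le_add_mul 1 fun x y => ?_
    have := real_inner_le_norm ξ (x - y)
    rw [hξ, one_mul] at this
    rw [dist_eq_norm, NNReal.coe_one, one_mul]
    have h2 : ⟪ξ, x - x₀⟫ = ⟪ξ, y - x₀⟫ + ⟪ξ, x - y⟫ := by
      rw [← inner_add_right]; congr 1; abel
    linarith
  have hG : LipschitzWith 1 G := (hlin.const_min _).const_max _
  have hM : ∀ x, |G x| ≤ ρ := fun x =>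
    abs_le.2 ⟨le_max_left _ _, max_le (by linarith [ρ.2]) (min_le_left _ _)⟩
  have hGderiv : ∀ x ∈ S, lineDeriv ℝ G x ξ = 1 := by
    intro x hx
    have hev : G =ᶠ[nhds x] fun x => ⟪ξ, x - x₀⟫ := by
      filter_upwards [hSo.mem_nhds hx] with y hy
      have := abs_lt.1 (hslab y hy)
      simp only [hGdef]
      rw [min_eq_right this.2.le, max_eq_right this.1.le]
    rw [hev.lineDeriv_eq]
    have hd1 : HasDerivAt (fun t : ℝ => ⟪ξ, x - x₀⟫ + t) 1 0 :=
      (hasDerivAt_id (0 : ℝ)).const_add _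
    refine HasLineDerivAt.lineDeriv ?_
    unfold HasLineDerivAt
    refine hd1.congr_of_eventuallyEq (Filter.Eventually.of_forall fun t => ?_)
    beta_reduce
    rw [add_sub_right_comm, inner_add_right, inner_smul_right, real_inner_self_eq_norm_sq, hξ]
    ring
  have hibp := setIntegral_lineDeriv_mul_boundaryCutoff_of_subset hXo hXb hSX hw hw0 hwS hG hM hδ ξ
  rw [← hη] at hibp
  set S' := AffineMap.homothety x₀ (1 / 2 : ℝ) '' S with hS'
  have hS'S : S' ⊆ S := by
    rintro _ ⟨z, hz, rfl⟩
    have := hSc hz hx₀ (by norm_num : (0 : ℝ) ≤ 1 / 2) (by norm_num : (0 : ℝ) ≤ 1 / 2) (by norm_num)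
    convert this using 1
    rw [AffineMap.homothety_apply, vsub_eq_sub, vadd_eq_add]
    module
  have hS'm : MeasurableSet S' :=
    (AffineMap.homothety_isOpenMap x₀ (1 / 2 : ℝ) (by norm_num) S hSo).measurableSet
  have hS'v : volume.real S' = (1 / 2) ^ n * volume.real S := by
    rw [hS', Measure.real, Measure.addHaar_image_homothety, ENNReal.toReal_mul,
      ENNReal.toReal_ofReal (abs_nonneg _), finrank_euclideanSpace_fin,
      abs_of_nonneg (by positivity)]
    rfl
  have hη1 : ∀ x ∈ S', η x = 1 := by
    rintro _ ⟨z, hz, rfl⟩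
    have := boundaryCutoff_homothety_eq_one hXc hX hd hball (by norm_num : (0 : ℝ) < 1 / 2)
      (by norm_num) (hSX hz)
    norm_num at this ⊢
    simpa [hη] using this
  have hGη : ∀ x, |G x * lineDeriv ℝ η x ξ| ≤ 2 * ρ / d := by
    intro x
    rw [abs_mul]
    calc |G x| * |lineDeriv ℝ η x ξ| ≤ ρ * (1 / 2 * d)⁻¹ :=
          mul_le_mul (hM x) (abs_lineDeriv_boundaryCutoff_le hδ x hξ) (abs_nonneg _) ρ.2
      _ = 2 * ρ / d := by field_simp
  have hη01 : ∀ x, 0 ≤ η x ∧ η x ≤ 1 := fun x =>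
    ⟨boundaryCutoff_nonneg hδ x, boundaryCutoff_le_one x⟩
  have hconst (c : ℝ) : Integrable (fun _ => c) (volume.restrict S) := integrableOn_const hSfin
  have hint1 : IntegrableOn (fun x => S'.indicator (fun _ => m) x - 2 * H * ρ / d) S :=
    ((hconst _).indicator hS'm).sub (hconst _)
  have hint2 : IntegrableOn (fun x => w x * (η x * lineDeriv ℝ G x ξ
      + G x * lineDeriv ℝ η x ξ)) S := by
    refine Measure.integrableOn_of_bounded (M := H * (1 + 2 * ρ / d)) hSfin ?_ ?_
    · have m1 := measurable_lineDeriv (𝕜 := ℝ) hG.continuous (v := ξ)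
      have m2 := measurable_lineDeriv (𝕜 := ℝ) hηl.continuous (v := ξ)
      have m3 := hG.continuous.measurable
      have m4 := hηl.continuous.measurable
      have m5 := hw.continuous.measurable
      exact (m5.mul ((m4.mul m1).add (m3.mul m2))).aestronglyMeasurable
    · filter_upwards [ae_restrict_mem hSo.measurableSet] with x hx
      rw [hGderiv x hx, mul_one, norm_mul, Real.norm_of_nonneg (hw0 x)]
      refine mul_le_mul (hH x hx) ?_ (norm_nonneg _) hH0
      refine (norm_add_le _ _).trans (add_le_add ?_ (hGη x))
      rw [Real.norm_of_nonneg (hη01 x).1]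
      exact (hη01 x).2
  have hlow : (m * (1 / 2) ^ n - 2 * H * ρ / d) * volume.real S
      ≤ ∫ x in S, w x * (η x * lineDeriv ℝ G x ξ + G x * lineDeriv ℝ η x ξ) := by
    calc _ = ∫ x in S, (S'.indicator (fun _ => m) x - 2 * H * ρ / d) := by
          rw [integral_sub ((hconst _).indicator hS'm) (hconst _),
            setIntegral_indicator hS'm, setIntegral_const, setIntegral_const,
            Set.inter_eq_self_of_subset_right hS'S, hS'v, smul_eq_mul, smul_eq_mul]
          ring
      _ ≤ _ := by
          refine setIntegral_mono_on hint1 hint2 hSo.measurableSet fun x hx => ?_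
          rw [hGderiv x hx, mul_one, mul_add]
          have h1 : -(2 * H * ρ / d) ≤ w x * (G x * lineDeriv ℝ η x ξ) := by
            have : |w x * (G x * lineDeriv ℝ η x ξ)| ≤ H * (2 * ρ / d) := by
              rw [abs_mul, abs_of_nonneg (hw0 x)]
              exact mul_le_mul (hH x hx) (hGη x) (abs_nonneg _) hH0
            have h' : H * (2 * ρ / d) = 2 * H * ρ / d := by ring
            linarith [(abs_le.1 this).1]
          have h2 : S'.indicator (fun _ => m) x ≤ w x * η x := by
            by_cases hxS : x ∈ S'
            · rw [Set.indicator_of_mem hxS, hη1 x hxS, mul_one]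
              obtain ⟨z, hz, rfl⟩ := hxS
              exact hwm z hz
            · rw [Set.indicator_of_notMem hxS]
              exact mul_nonneg (hw0 x) (hη01 x).1
          linarith
  refine hlow.trans ?_
  have hup : |∫ x in S, lineDeriv ℝ w x ξ * (η x * G x)|
      ≤ ∫ x in S, ρ * |lineDeriv ℝ w x ξ| := by
    rw [← Real.norm_eq_abs]
    refine norm_integral_le_of_norm_le ?_ (Filter.Eventually.of_forall fun x => ?_)
    · refine Measure.integrableOn_of_bounded (M := ρ * Cw) hSfin ?_
        (Filter.Eventually.of_forall fun x => ?_)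
      · exact ((measurable_lineDeriv (𝕜 := ℝ) hw.continuous (v := ξ)).norm.const_mul
          (ρ : ℝ)).aestronglyMeasurable
      · rw [norm_mul, Real.norm_of_nonneg ρ.coe_nonneg, Real.norm_eq_abs, abs_abs]
        have := norm_lineDeriv_le_of_lipschitz ℝ (x₀ := x) (v := ξ) hw
        rw [hξ, mul_one] at this
        exact mul_le_mul_of_nonneg_left this ρ.2
    · rw [norm_mul, mul_comm, Real.norm_eq_abs, Real.norm_eq_abs, abs_mul]
      refine mul_le_mul_of_nonneg_right ?_ (abs_nonneg _)
      rw [abs_of_nonneg (hη01 x).1]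
      calc _ ≤ 1 * (ρ : ℝ) := mul_le_mul (hη01 x).2 (hM x) (abs_nonneg _) zero_le_one
        _ = ρ := one_mul _
  rw [integral_const_mul] at hup
  rw [hibp, abs_neg] at hup
  exact (le_abs_self _).trans hup

end Section

section Energy

variable {n : ℕ} {X : Set (EuclideanSpace ℝ (Fin n))}

theorem measurable_gradient (v : EuclideanSpace ℝ (Fin n) → ℝ) : Measurable (gradient v) :=
  (InnerProductSpace.toDual ℝ (EuclideanSpace ℝ (Fin n))).symm.continuous.measurable.comp
    (measurable_fderiv ℝ v)

theorem norm_gradient_le_of_lipschitzOnWith (hXo : IsOpen X) {v : EuclideanSpace ℝ (Fin n) → ℝ}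
    {C : NNReal} (hv : LipschitzOnWith C v X) {x : EuclideanSpace ℝ (Fin n)} (hx : x ∈ X) :
    ‖gradient v x‖ ≤ C := by
  rw [gradient, LinearIsometryEquiv.norm_map]
  exact norm_fderiv_le_of_lipschitzOn ℝ (hXo.mem_nhds hx) hv

theorem exists_abs_le_of_lipschitzOnWith (hXb : Bornology.IsBounded X)
    {v : EuclideanSpace ℝ (Fin n) → ℝ} {C : NNReal} (hv : LipschitzOnWith C v X) :
    ∃ B : NNReal, ∀ x ∈ X, |v x| ≤ B := by
  obtain ⟨g, hg, hvg⟩ := hv.extend_real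
  obtain ⟨B, hB⟩ := hXb.isCompact_closure.exists_bound_of_continuousOn hg.continuous.continuousOn
  refine ⟨B.toNNReal, fun x hx => ?_⟩
  rw [hvg hx]
  exact (hB x (subset_closure hx)).trans (Real.le_coe_toNNReal B)

theorem integrableOn_rochetChone (hXo : IsOpen X) (hXb : Bornology.IsBounded X)
    {γ v : EuclideanSpace ℝ (Fin n) → ℝ} {C Kγ : NNReal} {q : ℝ} (hq : 0 ≤ q)
    (hv : LipschitzOnWith C v X) (hγ : LipschitzOnWith Kγ γ X) :
    IntegrableOn
      (fun x => (‖gradient v x‖ ^ q / q - ⟪x, gradient v x⟫ + v x) * γ x) X := by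
  obtain ⟨Bv, hBv⟩ := exists_abs_le_of_lipschitzOnWith hXb hv
  obtain ⟨Bγ, hBγ⟩ := exists_abs_le_of_lipschitzOnWith hXb hγ
  obtain ⟨D, hD⟩ := hXb.exists_norm_le
  have hm := measurable_gradient v
  have : IsFiniteMeasure (volume.restrict X) :=
    isFiniteMeasure_restrict.2 hXb.measure_lt_top.ne
  refine Integrable.of_bound (C := (C ^ q / q + D * C + Bv) * Bγ) ?_ ?_
  · refine AEStronglyMeasurable.mul (AEStronglyMeasurable.add ?_ ?_) ?_
    · exact ((hm.norm.pow_const q).div_const q |>.sub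
        (measurable_id.inner hm)).aestronglyMeasurable
    · exact hv.continuousOn.aestronglyMeasurable hXo.measurableSet
    · exact hγ.continuousOn.aestronglyMeasurable hXo.measurableSet
  · filter_upwards [ae_restrict_mem hXo.measurableSet] with x hx
    have h1 := norm_gradient_le_of_lipschitzOnWith hXo hv hx
    have h2 : ‖gradient v x‖ ^ q / q ≤ C ^ q / q := by gcongr
    have h3 : |⟪x, gradient v x⟫| ≤ D * C :=
      (abs_real_inner_le_norm _ _).trans
        (mul_le_mul (hD x hx) h1 (norm_nonneg _) ((norm_nonneg _).trans (hD x hx)))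
    rw [norm_mul]
    refine mul_le_mul ?_ (hBγ x hx) (norm_nonneg _) ?_
    · refine (norm_add_le _ _).trans (add_le_add ((norm_sub_le _ _).trans (add_le_add ?_ h3))
        (hBv x hx))
      rw [Real.norm_of_nonneg (by positivity)]
      exact h2
    · have := (abs_nonneg _).trans h3
      positivity

theorem hasGradientAt_inner_add_const (P x : EuclideanSpace ℝ (Fin n)) (c : ℝ) :
    HasGradientAt (fun z => ⟪P, z⟫ + c) P x := by
  rw [hasGradientAt_iff_hasFDerivAt]
  exact ((InnerProductSpace.toDual ℝ _ P).hasFDerivAt (x := x)).add_const c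

theorem isOpen_section (hXo : IsOpen X) {u : EuclideanSpace ℝ (Fin n) → ℝ}
    (hu : ContinuousOn u X) (P : EuclideanSpace ℝ (Fin n)) (c : ℝ) :
    IsOpen {x ∈ X | u x < ⟪P, x⟫ + c} := by
  have h2 : ContinuousOn (fun x => ⟪P, x⟫ + c - u x) X :=
    (by fun_prop : Continuous fun x => ⟪P, x⟫ + c).continuousOn.sub hu
  convert h2.isOpen_inter_preimage hXo (isOpen_Ioi (a := 0)) using 1
  ext p
  simp

/-- First-order minimality: raising `u` to an affine function on a section does not decrease the
energy. -/
theorem energy_section_nonneg (hXo : IsOpen X) (hXb : Bornology.IsBounded X)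
    {γ u : EuclideanSpace ℝ (Fin n) → ℝ} {R Kγ : NNReal} {q : ℝ} (hq : 0 ≤ q)
    (hγ : LipschitzOnWith Kγ γ X) (hu : LipschitzOnWith R u X)
    {P : EuclideanSpace ℝ (Fin n)} {c : ℝ}
    (hmin : rochetChone X γ q u ≤ rochetChone X γ q (fun x => max (u x) (⟪P, x⟫ + c))) :
    0 ≤ ∫ x in {x ∈ X | u x < ⟪P, x⟫ + c}, (‖P‖ ^ q / q - ‖gradient u x‖ ^ q / q
      - ⟪x, P - gradient u x⟫ + (⟪P, x⟫ + c - u x)) * γ x := by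
  set S := {x ∈ X | u x < ⟪P, x⟫ + c} with hS
  set v : EuclideanSpace ℝ (Fin n) → ℝ := fun x => max (u x) (⟪P, x⟫ + c) with hvdef
  have hSX : S ⊆ X := fun x hx => hx.1
  have haff : LipschitzWith ‖P‖₊ (fun x => ⟪P, x⟫ + c) := by
    have := ((innerSL ℝ P).lipschitz).add (LipschitzWith.const c)
    rw [add_zero, show ‖innerSL ℝ P‖₊ = ‖P‖₊ from NNReal.eq (innerSL_apply_norm ℝ P)] at this
    exact this
  have hSo : IsOpen S := isOpen_section hXo hu.continuousOn P c
  have hv : LipschitzOnWith (max R ‖P‖₊) v X := by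
    rw [lipschitzOnWith_iff_restrict] at hu ⊢
    exact hu.max ((lipschitzOnWith_iff_restrict.1 haff.lipschitzOnWith))
  have hui := integrableOn_rochetChone hXo hXb hq hu hγ
  have hvi := integrableOn_rochetChone hXo hXb hq hv hγ
  have hgv : ∀ᵐ x ∂(volume.restrict X), x ∉ S → gradient v x = gradient u x := by
    have hdu := hu.ae_differentiableWithinAt (μ := volume) hXo.measurableSet
    have hdv := hv.ae_differentiableWithinAt (μ := volume) hXo.measurableSet
    filter_upwards [hdu, hdv, ae_restrict_mem hXo.measurableSet] with x h1 h2 hx hxS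
    have h1' := h1.differentiableAt (hXo.mem_nhds hx)
    have h2' := h2.differentiableAt (hXo.mem_nhds hx)
    have hle : ⟪P, x⟫ + c ≤ u x := not_lt.1 fun h => hxS ⟨hx, h⟩
    have hloc : IsLocalMin (fun z => v z - u z) x := by
      refine Filter.Eventually.of_forall fun z => ?_
      simp only [hvdef, max_eq_left hle, sub_self]
      exact sub_nonneg.2 (le_max_left _ _)
    have h0 := hloc.hasFDerivAt_eq_zero (h2'.hasFDerivAt.sub h1'.hasFDerivAt)
    rw [gradient, gradient, sub_eq_zero.1 h0]
  have hgS : ∀ x ∈ S, gradient v x = P := by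
    intro x hx
    have hev : v =ᶠ[nhds x] fun z => ⟪P, z⟫ + c := by
      filter_upwards [hSo.mem_nhds hx] with z hz
      exact max_eq_right hz.2.le
    rw [hev.gradient_eq, (hasGradientAt_inner_add_const P x c).gradient]
  have hdiff : rochetChone X γ q v - rochetChone X γ q u
      = ∫ x in S, (‖P‖ ^ q / q - ‖gradient u x‖ ^ q / q
        - ⟪x, P - gradient u x⟫ + (⟪P, x⟫ + c - u x)) * γ x := by
    rw [rochetChone, rochetChone, ← integral_sub hvi hui]
    rw [setIntegral_eq_of_subset_of_ae_sdiff_eq_zero hXo.nullMeasurableSet hSX]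
    · refine setIntegral_congr_fun hSo.measurableSet fun x hx => ?_
      have hvx : v x = ⟪P, x⟫ + c := max_eq_right hx.2.le
      simp only [hgS x hx, hvx, inner_sub_right]
      ring
    · filter_upwards [(ae_restrict_iff' hXo.measurableSet).1 hgv] with x hx hxd
      have hvx : v x = u x := max_eq_left (not_lt.1 fun h => hxd.2 ⟨hxd.1, h⟩)
      simp only [hx hxd.1 hxd.2, hvx, sub_self]
  rw [← hdiff]
  linarith

end Energy

section SectionEstimate

variable {n : ℕ} {X : Set (EuclideanSpace ℝ (Fin n))}

theorem exists_lipschitzWith_extension_bounded {g : EuclideanSpace ℝ (Fin n) → ℝ} {C M : NNReal}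
    (hg : LipschitzOnWith C g X) (hM : ∀ x ∈ X, |g x| ≤ M) :
    ∃ G : EuclideanSpace ℝ (Fin n) → ℝ,
      LipschitzWith C G ∧ (∀ x, |G x| ≤ M) ∧ ∀ x ∈ X, G x = g x := by
  obtain ⟨G, hG, hgG⟩ := hg.extend_real
  refine ⟨fun x => max (-(M : ℝ)) (min (M : ℝ) (G x)), (hG.const_min _).const_max _, fun x => ?_,
    fun x hx => ?_⟩
  · exact abs_le.2 ⟨le_max_left _ _, max_le (by linarith [M.coe_nonneg]) (min_le_left _ _)⟩
  · have := abs_le.1 (hM x hx)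
    dsimp only
    rw [← hgG hx, min_eq_right this.2, max_eq_right this.1]

theorem lipschitzOnWith_mul_inner_sub {γ : EuclideanSpace ℝ (Fin n) → ℝ} {Kγ Γ B : NNReal}
    (hγ : LipschitzOnWith Kγ γ X) (hΓ : ∀ x ∈ X, |γ x| ≤ Γ) {A e : EuclideanSpace ℝ (Fin n)}
    (hB : ∀ x ∈ X, ‖A - x‖ ≤ B) (he : ‖e‖ = 1) :
    LipschitzOnWith (Γ + B * Kγ) (fun x => γ x * ⟪A - x, e⟫) X := by
  refine LipschitzOnWith.of_dist_le_mul fun x hx y hy => ?_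
  have h1 := hγ.dist_le_mul x hx y hy
  have hid : γ x * ⟪A - x, e⟫ - γ y * ⟪A - y, e⟫
      = γ x * ⟪y - x, e⟫ + ⟪A - y, e⟫ * (γ x - γ y) := by
    rw [show A - x = (A - y) + (y - x) by abel, inner_add_left]; ring
  have h2 : |⟪y - x, e⟫| ≤ dist x y := by
    simpa [he, dist_eq_norm, norm_sub_rev] using abs_real_inner_le_norm (y - x) e
  have h3 : |⟪A - y, e⟫| ≤ B :=
    (abs_real_inner_le_norm (A - y) e).trans (by rw [he, mul_one]; exact hB y hy)
  rw [Real.dist_eq] at h1 ⊢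
  rw [hid]
  refine (abs_add_le _ _).trans ?_
  rw [abs_mul, abs_mul]
  push_cast
  have h4 := mul_le_mul (hΓ x hx) h2 (abs_nonneg _) Γ.2
  have h5 := mul_le_mul h3 h1 (abs_nonneg _) B.2
  linarith

/-- On a section of `u`, the derivative of the gap function is `P - ∇u`. -/
theorem ae_lineDeriv_section {u w : EuclideanSpace ℝ (Fin n) → ℝ} {R : NNReal}
    (hu : LipschitzOnWith R u X) {P : EuclideanSpace ℝ (Fin n)} {c : ℝ}
    {S : Set (EuclideanSpace ℝ (Fin n))} (hSX : S ⊆ X) (hSo : IsOpen S)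
    (hw : ∀ x ∈ S, w x = ⟪P, x⟫ + c - u x) :
    ∀ᵐ x ∂(volume.restrict S), ∀ e, lineDeriv ℝ w x e = ⟪P - gradient u x, e⟫ := by
  have hd := (hu.mono hSX).ae_differentiableWithinAt (μ := volume) hSo.measurableSet
  filter_upwards [hd, ae_restrict_mem hSo.measurableSet] with x h1 hx e
  have h2 := (h1.differentiableAt (hSo.mem_nhds hx)).hasGradientAt
  have hev : w =ᶠ[nhds x] fun z => (⟪P, z⟫ + c) - u z := by
    filter_upwards [hSo.mem_nhds hx] with z hz using hw z hz
  rw [hev.lineDeriv_eq]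
  have h3 := (hasGradientAt_inner_add_const P x c).hasFDerivAt.sub h2.hasFDerivAt
  have h4 := (h3.hasLineDerivAt e).lineDeriv
  simp only [← map_sub, InnerProductSpace.toDual_apply_apply] at h4
  exact h4

/-- Energy comparison on a section `S = {u < ⟪P, ·⟫ + c}`: the `q`-energy of the gap is controlled
by its height times the volume of `S`. -/
theorem setIntegral_norm_rpow_section_le (hXo : IsOpen X) (hXb : Bornology.IsBounded X)
    (hXc : Convex ℝ X) (hX : Xᶜ.Nonempty)
    {γ u w : EuclideanSpace ℝ (Fin n) → ℝ} {R Kγ Γ D Cw : NNReal} {q lam : ℝ} (hq : 2 < q)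
    (hγ : LipschitzOnWith Kγ γ X) (hΓ : ∀ x ∈ X, |γ x| ≤ Γ) (hγlb : ∀ x ∈ X, lam ≤ γ x)
    (hlam : 0 < lam) (hD : ∀ x ∈ X, ‖x‖ ≤ D)
    (hu : LipschitzOnWith R u X)
    {P : EuclideanSpace ℝ (Fin n)} (hP : ‖P‖ ≤ R) {c : ℝ}
    (hmin : rochetChone X γ q u ≤ rochetChone X γ q (fun x => max (u x) (⟪P, x⟫ + c)))
    {S : Set (EuclideanSpace ℝ (Fin n))} (hS : S = {x ∈ X | u x < ⟪P, x⟫ + c})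
    (hSc : Convex ℝ S) (hSo : IsOpen S)
    (hw : LipschitzWith Cw w) (hw0 : ∀ x, 0 ≤ w x) (hwS : ∀ x ∈ X \ S, w x = 0)
    (hwu : ∀ x ∈ S, w x = ⟪P, x⟫ + c - u x)
    {H : ℝ} (hH : ∀ x ∈ S, w x ≤ H) {x₀ : EuclideanSpace ℝ (Fin n)} (hx₀ : x₀ ∈ S)
    {d : ℝ} (hd : 0 < d) (hball : Metric.ball x₀ d ⊆ X) :
    2 * (1 / 2) ^ q / q * lam * ∫ x in S, ‖P - gradient u x‖ ^ q ≤
      H * (n * (Γ + (R ^ (q - 1) + D) * Kγ + n * (Γ * (R ^ (q - 1) + D)) / d) + Γ)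
        * volume.real S := by
  have hq0 : 0 < q := by linarith
  have hSX : S ⊆ X := by rw [hS]; exact fun x hx => hx.1
  have hSfin : volume S ≠ ⊤ := (hXb.subset hSX).measure_lt_top.ne
  have hfin : IsFiniteMeasure (volume.restrict S) := isFiniteMeasure_restrict.2 hSfin
  have hH0 : 0 ≤ H := (hw0 x₀).trans (hH x₀ hx₀)
  set κ : ℝ := 2 * (1 / 2) ^ q / q with hκ
  have hκ0 : 0 ≤ κ := by positivity
  set A := ‖P‖ ^ (q - 2) • P with hA
  set B : NNReal := R ^ (q - 1) + D with hBdef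
  have hAn : ‖A‖ ≤ R ^ (q - 1) := by
    rw [hA, norm_smul, Real.norm_of_nonneg (by positivity),
      ← Real.rpow_add_one' (norm_nonneg P) (by linarith), show q - 2 + 1 = q - 1 by ring]
    exact Real.rpow_le_rpow (norm_nonneg P) hP (by linarith)
  have hB : ∀ x ∈ X, ‖A - x‖ ≤ B := fun x hx => by
    refine (norm_sub_le _ _).trans ?_
    rw [hBdef]
    push_cast
    exact add_le_add hAn (hD x hx)
  set b := EuclideanSpace.basisFun (Fin n) ℝ with hb
  have hb1 : ∀ i, ‖b i‖ = 1 := fun i => b.orthonormal.1 i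
  obtain ⟨γe, hγe, hγeΓ, hγγe⟩ := exists_lipschitzWith_extension_bounded hγ hΓ
  have hG : ∀ i, ∃ G : EuclideanSpace ℝ (Fin n) → ℝ,
      LipschitzWith (Γ + B * Kγ) G ∧ (∀ x, |G x| ≤ (Γ * B : NNReal)) ∧
      ∀ x ∈ X, G x = γ x * ⟪A - x, b i⟫ := by
    intro i
    refine exists_lipschitzWith_extension_bounded
      (lipschitzOnWith_mul_inner_sub hγ hΓ hB (hb1 i)) fun x hx => ?_
    rw [abs_mul]
    push_cast
    refine mul_le_mul (hΓ x hx) ((abs_real_inner_le_norm _ _).trans ?_) (abs_nonneg _) Γ.2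
    rw [hb1, mul_one]
    exact_mod_cast hB x hx
  choose G hGl hGM hGe using hG
  have hgrad := measurable_gradient u
  have hgradb : ∀ x ∈ S, ‖gradient u x‖ ≤ R := fun x hx =>
    norm_gradient_le_of_lipschitzOnWith hXo hu (hSX hx)
  have hint1 : ∀ i, Integrable (fun x => lineDeriv ℝ w x (b i) * G i x) (volume.restrict S) := by
    intro i
    refine Integrable.of_bound (C := Cw * (Γ * B : NNReal))
      ((measurable_lineDeriv (𝕜 := ℝ) hw.continuous).mul
        (hGl i).continuous.measurable).aestronglyMeasurable
      (Filter.Eventually.of_forall fun x => ?_)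
    rw [norm_mul]
    refine mul_le_mul ?_ (hGM i x) (norm_nonneg _) Cw.2
    simpa [hb1] using norm_lineDeriv_le_of_lipschitz ℝ (x₀ := x) (v := b i) hw
  have hwγ : ∀ x ∈ S, |w x * γe x| ≤ H * Γ := fun x hx => by
    rw [abs_mul, abs_of_nonneg (hw0 x)]
    exact mul_le_mul (hH x hx) (hγeΓ x) (abs_nonneg _) hH0
  have hint2 : Integrable (fun x => w x * γe x) (volume.restrict S) := by
    refine Integrable.of_bound (C := H * Γ)
      (hw.continuous.mul hγe.continuous).aestronglyMeasurable ?_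
    filter_upwards [ae_restrict_mem hSo.measurableSet] with x hx using hwγ x hx
  have hint3 : Integrable (fun x => ‖P - gradient u x‖ ^ q) (volume.restrict S) := by
    refine Integrable.of_bound (C := (R + R) ^ q)
      ((measurable_const.sub hgrad).norm.pow_const q).aestronglyMeasurable ?_
    filter_upwards [ae_restrict_mem hSo.measurableSet] with x hx
    rw [Real.norm_of_nonneg (by positivity)]
    exact Real.rpow_le_rpow (norm_nonneg _)
      ((norm_sub_le _ _).trans (add_le_add hP (hgradb x hx))) hq0.le
  have hint4 : Integrable (fun x => (‖P‖ ^ q / q - ‖gradient u x‖ ^ q / q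
      - ⟪x, P - gradient u x⟫ + (⟪P, x⟫ + c - u x)) * γ x) (volume.restrict S) := by
    have h1 : Integrable (fun x => (‖gradient u x‖ ^ q / q - ⟪x, gradient u x⟫ + u x) * γ x)
        (volume.restrict S) :=
      (integrableOn_rochetChone hXo hXb hq0.le hu hγ).mono_set hSX
    have h2 : Integrable γ (volume.restrict S) := by
      refine Integrable.of_bound (C := Γ)
        ((hγ.continuousOn.mono hSX).aestronglyMeasurable hSo.measurableSet) ?_
      filter_upwards [ae_restrict_mem hSo.measurableSet] with x hx using hΓ x (hSX hx)
    refine ((h2.const_mul (‖P‖ ^ q / q + c)).sub h1).congr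
      (Filter.Eventually.of_forall fun x => ?_)
    simp only [Pi.sub_apply, inner_sub_right, real_inner_comm x P]
    ring
  have hintsum : Integrable (fun x => ∑ i, lineDeriv ℝ w x (b i) * G i x) (volume.restrict S) :=
    integrable_finsetSum _ fun i _ => hint1 i
  have hint12 : Integrable (fun x => (∑ i, lineDeriv ℝ w x (b i) * G i x) + w x * γe x)
      (volume.restrict S) := hintsum.add hint2
  have hnonneg := energy_section_nonneg hXo hXb hq0.le hγ hu hmin
  rw [← hS] at hnonneg
  have hmono : ∫ x in S, (‖P‖ ^ q / q - ‖gradient u x‖ ^ q / q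
      - ⟪x, P - gradient u x⟫ + (⟪P, x⟫ + c - u x)) * γ x
      ≤ ∫ x in S, ((∑ i, lineDeriv ℝ w x (b i) * G i x) + w x * γe x
        - κ * lam * ‖P - gradient u x‖ ^ q) := by
    refine integral_mono_ae hint4 (hint12.sub (hint3.const_mul _)) ?_
    filter_upwards [ae_lineDeriv_section hu hSX hSo hwu,
      ae_restrict_mem hSo.measurableSet] with x hx hxS
    have hsum : ∑ i, lineDeriv ℝ w x (b i) * G i x = ⟪A - x, P - gradient u x⟫ * γ x := by
      rw [← b.sum_inner_mul_inner, Finset.sum_mul]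
      refine Finset.sum_congr rfl fun i _ => ?_
      rw [hx, hGe i x (hSX hxS), real_inner_comm (P - gradient u x) (b i)]
      ring
    have huc := norm_rpow_uniform_convexity hq P (gradient u x)
    rw [← hκ, ← hA, ← neg_sub P (gradient u x), inner_neg_right, norm_neg] at huc
    have hγx := hγlb x (hSX hxS)
    have hγ0 : 0 < γ x := hlam.trans_le hγx
    rw [hsum, hγγe x (hSX hxS), hwu x hxS, inner_sub_left]
    have h6 : κ * lam * ‖P - gradient u x‖ ^ q ≤ κ * ‖P - gradient u x‖ ^ q * γ x := by
      have : 0 ≤ κ * ‖P - gradient u x‖ ^ q := by positivity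
      nlinarith
    have h7 := mul_le_mul_of_nonneg_right huc hγ0.le
    nlinarith
  rw [integral_sub hint12 (hint3.const_mul _), integral_add hintsum hint2,
    integral_finsetSum _ fun i _ => hint1 i, integral_const_mul] at hmono
  have hsum : ∑ i, ∫ x in S, lineDeriv ℝ w x (b i) * G i x
      ≤ n * (H * ((Γ + B * Kγ : NNReal) + n * (Γ * B : NNReal) / d) * volume.real S) := by
    calc _ ≤ ∑ i : Fin n, H * ((Γ + B * Kγ : NNReal) + n * (Γ * B : NNReal) / d) * volume.real S :=
          Finset.sum_le_sum fun i _ => (le_abs_self _).trans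
            (abs_setIntegral_lineDeriv_mul_le hXo hXb hXc hX hSX hSc hSo hw hw0 hwS hH (hGl i)
              (hGM i) hx₀ hd hball (hb1 i))
      _ = _ := by simp
  have hwγint : ∫ x in S, w x * γe x ≤ H * Γ * volume.real S := by
    have := setIntegral_mono_on hint2 (integrableOn_const (C := H * Γ) hSfin) hSo.measurableSet
      fun x hx => (le_abs_self _).trans (hwγ x hx)
    rwa [setIntegral_const, smul_eq_mul, mul_comm (volume.real S)] at this
  rw [hBdef] at hsum
  push_cast at hsum
  nlinarith

end SectionEstimate

section KeyEstimate

variable {n : ℕ} {X : Set (EuclideanSpace ℝ (Fin n))}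

theorem rpow_mul_measureReal_le_integral {Ω : Type*} [MeasurableSpace Ω] {μ : Measure Ω}
    [IsFiniteMeasure μ] {q b : ℝ} (hq : 2 < q) (hb : 0 ≤ b) {f : Ω → ℝ} (hf0 : ∀ x, 0 ≤ f x)
    (hf : Integrable f μ) (hfq : Integrable (fun x => f x ^ q) μ)
    (hbf : b * μ.real Set.univ ≤ ∫ x, f x ∂μ) :
    b ^ q * μ.real Set.univ ≤ ∫ x, f x ^ q ∂μ := by
  have hpt : ∀ x, b ^ q / q + b ^ (q - 2) * b * (f x - b) ≤ f x ^ q / q := fun x => by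
    have := norm_rpow_gradient_inequality hq b (f x)
    simp only [Real.norm_of_nonneg hb, Real.norm_of_nonneg (hf0 x), smul_eq_mul,
      RCLike.inner_apply, conj_trivial] at this
    linarith
  have hsub : Integrable (fun x => b ^ (q - 2) * b * (f x - b)) μ :=
    (hf.sub (integrable_const b)).const_mul _
  have hint := integral_mono ((integrable_const (b ^ q / q)).add hsub) (hfq.div_const q) hpt
  simp only [Pi.add_apply] at hint
  rw [integral_add (integrable_const _) hsub, integral_const_mul,
    integral_sub hf (integrable_const b), integral_const, integral_const, integral_div,
    smul_eq_mul, smul_eq_mul] at hint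
  have h1 : 0 ≤ b ^ (q - 2) * b * (∫ x, f x ∂μ - μ.real Set.univ * b) :=
    mul_nonneg (mul_nonneg (Real.rpow_nonneg hb _) hb) (by linarith)
  have h2 : μ.real Set.univ * (b ^ q / q) ≤ (∫ x, f x ^ q ∂μ) / q := by linarith
  rw [← mul_div_assoc, div_le_div_iff_of_pos_right (by linarith)] at h2
  linarith

/-- The positive part of an affine function minus `u` extends to a Lipschitz function. -/
theorem exists_lipschitzWith_gap {u : EuclideanSpace ℝ (Fin n) → ℝ} {R : NNReal}
    (hu : LipschitzOnWith R u X) (P : EuclideanSpace ℝ (Fin n)) (c : ℝ) :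
    ∃ (Cw : NNReal) (w : EuclideanSpace ℝ (Fin n) → ℝ), LipschitzWith Cw w ∧
      (∀ x, 0 ≤ w x) ∧ ∀ x ∈ X, w x = max (⟪P, x⟫ + c - u x) 0 := by
  obtain ⟨g, hg, hug⟩ := hu.extend_real
  refine ⟨_, fun x => max (⟪P, x⟫ + c - g x) 0,
    ((((innerSL ℝ P).lipschitz).add (LipschitzWith.const c)).sub hg).max_const 0,
    fun x => le_max_right _ _, fun x hx => ?_⟩
  dsimp only
  rw [hug hx]

theorem convex_section {u : EuclideanSpace ℝ (Fin n) → ℝ} (hu : ConvexOn ℝ X u)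
    (P : EuclideanSpace ℝ (Fin n)) (c : ℝ) : Convex ℝ {x ∈ X | u x < ⟪P, x⟫ + c} := by
  have h := (hu.sub ((innerₗ _ P).concaveOn hu.1)).convex_lt c
  have hset : {x ∈ X | u x < ⟪P, x⟫ + c} =
      {x ∈ X | (u - ⇑((innerₗ (EuclideanSpace ℝ (Fin n))) P)) x < c} := by
    ext x
    simp [sub_lt_iff_lt_add']
  rwa [hset]

/-- Two subgradients at points at distance at most `r` differ by at most a constant times
`r ^ (1 / (q - 1))`, in multiplied-out form. -/
theorem norm_subgrad_sub_rpow_le (hXo : IsOpen X) (hXb : Bornology.IsBounded X)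
    (hX : Xᶜ.Nonempty)
    {γ u : EuclideanSpace ℝ (Fin n) → ℝ} {R Kγ Γ D : NNReal} {q lam : ℝ} (hq : 2 < q)
    (hγ : LipschitzOnWith Kγ γ X) (hΓ : ∀ x ∈ X, |γ x| ≤ Γ) (hγlb : ∀ x ∈ X, lam ≤ γ x)
    (hlam : 0 < lam) (hD : ∀ x ∈ X, ‖x‖ ≤ D) (hu : LipschitzOnWith R u X)
    (huc : ConvexOn ℝ X u) {p₀ p₁ x₀ x₁ : EuclideanSpace ℝ (Fin n)}
    (hx₁ : x₁ ∈ X) (hp₀ : p₀ ∈ subgrad X u x₀) (hp₁ : p₁ ∈ subgrad X u x₁)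
    (hP : ‖(1 / 2 : ℝ) • (p₀ + p₁)‖ ≤ R)
    (hmin : ∀ c, rochetChone X γ q u ≤
      rochetChone X γ q (fun x => max (u x) (⟪(1 / 2 : ℝ) • (p₀ + p₁), x⟫ + c)))
    {d r : ℝ} (hd : 0 < d) (hball : Metric.ball x₀ d ⊆ X) (hr : 0 < r) (hxr : ‖x₁ - x₀‖ ≤ r)
    (hrd : r ≤ d * (1 / 2) ^ n / 48) (hp : p₁ ≠ p₀) :
    2 * (1 / 2) ^ q / q * lam * (‖p₁ - p₀‖ * (1 / 2) ^ n / 24) ^ q ≤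
      ‖p₁ - p₀‖ * r *
        (n * (Γ + (R ^ (q - 1) + D) * Kγ + n * (Γ * (R ^ (q - 1) + D)) / d) + Γ) := by
  have hq0 : 0 < q := by linarith
  have hx₀ : x₀ ∈ X := hball (Metric.mem_ball_self hd)
  set k := ‖p₁ - p₀‖ with hk
  have hk0 : 0 < k := norm_pos_iff.2 (sub_ne_zero.2 hp)
  set P : EuclideanSpace ℝ (Fin n) := (1 / 2 : ℝ) • (p₀ + p₁) with hPdef
  set c : ℝ := u x₀ - ⟪P, x₀⟫ + k * r / 2 with hc
  set ξ : EuclideanSpace ℝ (Fin n) := k⁻¹ • (p₁ - p₀) with hξdef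
  have hξ : ‖ξ‖ = 1 := by
    rw [hξdef, norm_smul, norm_inv, norm_norm, inv_mul_cancel₀ hk0.ne']
  have hkξ : p₁ - p₀ = k • ξ := by rw [hξdef, smul_smul, mul_inv_cancel₀ hk0.ne', one_smul]
  obtain ⟨Cw, w, hw, hw0, hwX⟩ := exists_lipschitzWith_gap hu P c
  set S := {x ∈ X | u x < ⟪P, x⟫ + c} with hS
  have hSX : S ⊆ X := fun x hx => hx.1
  have hSo : IsOpen S := isOpen_section hXo hu.continuousOn P c
  have hSc : Convex ℝ S := convex_section huc P c
  have hwS : ∀ x ∈ X \ S, w x = 0 := fun x hx => by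
    rw [hwX x hx.1]
    exact max_eq_right (sub_nonpos.2 (not_lt.1 fun h => hx.2 ⟨hx.1, h⟩))
  have hwu : ∀ x ∈ S, w x = ⟪P, x⟫ + c - u x := fun x hx => by
    rw [hwX x hx.1]
    exact max_eq_left (sub_nonneg.2 hx.2.le)
  have hgap : ∀ x, ⟪P, x⟫ + c - u x
      = u x₀ + ⟪p₀, x - x₀⟫ - u x + k * ⟪ξ, x - x₀⟫ / 2 + k * r / 2 := fun x => by
    have h1 : P = p₀ + (1 / 2 : ℝ) • (k • ξ) := by
      rw [← hkξ, hPdef]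
      module
    have h2 : ⟪P, x⟫ - ⟪P, x₀⟫ = ⟪p₀, x - x₀⟫ + k * ⟪ξ, x - x₀⟫ / 2 := by
      rw [← inner_sub_right, h1, inner_add_left, real_inner_smul_left, real_inner_smul_left]
      ring
    linarith
  have hupper₀ : ∀ x ∈ X, ⟪P, x⟫ + c - u x ≤ k * ⟪ξ, x - x₀⟫ / 2 + k * r / 2 := fun x hx => by
    linarith [hgap x, hp₀ x hx]
  have hupper₁ : ∀ x ∈ X, ⟪P, x⟫ + c - u x ≤ -(k * ⟪ξ, x - x₀⟫) / 2 + 3 * (k * r) / 2 :=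
    fun x hx => by
    have h1 := hp₀ x₁ hx₁
    have h2 := hp₁ x hx
    have h3 : ⟪p₁, x - x₁⟫ = ⟪p₀, x - x₀⟫ - ⟪p₀, x₁ - x₀⟫ + k * ⟪ξ, x - x₀⟫
        - ⟪p₁ - p₀, x₁ - x₀⟫ := by
      rw [show x - x₁ = (x - x₀) - (x₁ - x₀) by abel,
        ← real_inner_smul_left, ← hkξ]
      simp only [inner_sub_left, inner_sub_right]
      ring
    have h4 : ⟪p₁ - p₀, x₁ - x₀⟫ ≤ k * r :=
      (real_inner_le_norm _ _).trans (mul_le_mul_of_nonneg_left hxr hk0.le)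
    linarith [hgap x]
  have hkr : 0 < k * r := mul_pos hk0 hr
  have hx₀S : x₀ ∈ S := ⟨hx₀, by have := hgap x₀; simp at this; linarith⟩
  have hwx₀ : w x₀ = k * r / 2 := by rw [hwu x₀ hx₀S, hgap]; simp
  have hH : ∀ x ∈ S, w x ≤ k * r := fun x hx => by
    rw [hwu x hx]
    linarith [hupper₀ x hx.1, hupper₁ x hx.1]
  have hslab : ∀ x ∈ S, |⟪ξ, x - x₀⟫| < (3 * r).toNNReal := fun x hx => by
    rw [Real.coe_toNNReal _ (by positivity), abs_lt]
    have h0 : 0 < ⟪P, x⟫ + c - u x := sub_pos.2 hx.2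
    have h1 : 0 < k * (⟪ξ, x - x₀⟫ + r) := by linarith [hupper₀ x hx.1]
    have h2 : 0 < k * (3 * r - ⟪ξ, x - x₀⟫) := by linarith [hupper₁ x hx.1]
    rw [mul_pos_iff_of_pos_left hk0] at h1 h2
    exact ⟨by linarith, by linarith⟩
  have hwm : ∀ z ∈ S, k * r / 4 ≤ w (AffineMap.homothety x₀ (1 / 2 : ℝ) z) := fun z hz => by
    have hh : AffineMap.homothety x₀ (1 / 2 : ℝ) z = (1 / 2 : ℝ) • z + (1 / 2 : ℝ) • x₀ := by
      rw [AffineMap.homothety_apply]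
      simp only [vsub_eq_sub, vadd_eq_add]
      module
    have hmem := hSc hz hx₀S (by norm_num : (0 : ℝ) ≤ 1 / 2) (by norm_num : (0 : ℝ) ≤ 1 / 2)
      (by norm_num)
    have hcv := huc.2 hz.1 hx₀ (by norm_num : (0 : ℝ) ≤ 1 / 2) (by norm_num : (0 : ℝ) ≤ 1 / 2)
      (by norm_num)
    rw [hh, hwu _ hmem, inner_add_right, real_inner_smul_right, real_inner_smul_right]
    have h1 := hwu x₀ hx₀S
    have h2 := hz.2
    simp only [smul_eq_mul] at hcv
    linarith
  have hlow := le_setIntegral_abs_lineDeriv hXo hXb huc.1 hX hSX hSc hSo hw hw0 hwS hH hx₀S hd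
    hball hξ hslab hwm
  have hup := setIntegral_norm_rpow_section_le hXo hXb huc.1 hX hq hγ hΓ hγlb hlam hD hu hP
    (hmin c) hS hSc hSo hw hw0 hwS hwu hH hx₀S hd hball
  have hSfin : volume S ≠ ⊤ := (hXb.subset hSX).measure_lt_top.ne
  have hfin : IsFiniteMeasure (volume.restrict S) := isFiniteMeasure_restrict.2 hSfin
  have hSpos : 0 < volume.real S :=
    ENNReal.toReal_pos (hSo.measure_pos volume ⟨x₀, hx₀S⟩).ne' hSfin
  have hmeas := (measurable_const (a := P)).sub (measurable_gradient u)
  have hbd : ∀ x ∈ S, ‖P - gradient u x‖ ≤ R + R := fun x hx =>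
    (norm_sub_le _ _).trans
      (add_le_add hP (norm_gradient_le_of_lipschitzOnWith hXo hu (hSX hx)))
  have hint : Integrable (fun x => ‖P - gradient u x‖) (volume.restrict S) := by
    refine Integrable.of_bound (C := R + R) hmeas.norm.aestronglyMeasurable ?_
    filter_upwards [ae_restrict_mem hSo.measurableSet] with x hx
    rw [norm_norm]
    exact hbd x hx
  have hintq : Integrable (fun x => ‖P - gradient u x‖ ^ q) (volume.restrict S) := by
    refine Integrable.of_bound (C := (R + R) ^ q)
      (hmeas.norm.pow_const q).aestronglyMeasurable ?_
    filter_upwards [ae_restrict_mem hSo.measurableSet] with x hx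
    rw [Real.norm_of_nonneg (by positivity)]
    exact Real.rpow_le_rpow (norm_nonneg _) (hbd x hx) hq0.le
  have hle : ∫ x in S, |lineDeriv ℝ w x ξ| ≤ ∫ x in S, ‖P - gradient u x‖ := by
    refine integral_mono_of_nonneg (Filter.Eventually.of_forall fun x => abs_nonneg _) hint ?_
    filter_upwards [ae_lineDeriv_section hu hSX hSo hwu] with x hx
    rw [hx]
    simpa [hξ] using abs_real_inner_le_norm (P - gradient u x) ξ
  have hjensen : (k * (1 / 2) ^ n / 24) ^ q * volume.real S
      ≤ ∫ x in S, ‖P - gradient u x‖ ^ q := by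
    have := rpow_mul_measureReal_le_integral (μ := volume.restrict S)
      (b := k * (1 / 2) ^ n / 24) hq (by positivity) (fun x => norm_nonneg _) hint hintq
    simp only [measureReal_restrict_apply_univ] at this
    refine this (le_trans ?_ hle)
    rw [Real.coe_toNNReal _ (by positivity)] at hlow
    have h1 : 3 * r * (k * (1 / 2) ^ n / 24)
        ≤ k * r / 4 * (1 / 2) ^ n - 2 * (k * r) * (3 * r) / d := by
      have h2 : r / d ≤ (1 / 2) ^ n / 48 := by
        rw [div_le_iff₀ hd]
        linarith
      have h3 := mul_le_mul_of_nonneg_left h2 hkr.le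
      have h4 : 2 * (k * r) * (3 * r) / d = 6 * (k * r * (r / d)) := by ring
      linarith
    have h5 := mul_le_mul_of_nonneg_right h1 hSpos.le
    have h6 : 0 < 3 * r := by positivity
    refine le_of_mul_le_mul_left ?_ h6
    linarith
  have hκ : 0 ≤ 2 * (1 / 2) ^ q / q * lam := by positivity
  refine le_of_mul_le_mul_right ?_ hSpos
  linarith [mul_le_mul_of_nonneg_left hjensen hκ]

end KeyEstimate

section Regularity

variable {n : ℕ} {X : Set (EuclideanSpace ℝ (Fin n))}

/-- A Hölder-type modulus of continuity for the subdifferential of a minimizer, uniform over points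
at distance at least `d` from the complement of `X`. -/
theorem exists_norm_subgrad_sub_le {Y : Set (EuclideanSpace ℝ (Fin n))}
    (hXo : IsOpen X) (hXb : Bornology.IsBounded X) (hX : Xᶜ.Nonempty) (hYc : Convex ℝ Y)
    {a₀ : ℝ} {y₀ : EuclideanSpace ℝ (Fin n)} {q : ℝ} (hq : 2 < q)
    {γ : EuclideanSpace ℝ (Fin n) → ℝ} {Kγ : NNReal} (hγ : LipschitzOnWith Kγ γ X)
    {lam : ℝ} (hlam : 0 < lam) (hγlb : ∀ x ∈ X, lam ≤ γ x)
    {u : EuclideanSpace ℝ (Fin n) → ℝ} (hu : admissible X Y a₀ y₀ u)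
    (hmin : ∀ v, admissible X Y a₀ y₀ v → rochetChone X γ q u ≤ rochetChone X γ q v)
    {R : NNReal} (hR : ∀ p ∈ closure Y, ‖p‖ ≤ R) {d : ℝ} (hd : 0 < d) :
    ∃ C : ℝ, 0 ≤ C ∧ ∀ x₀ x₁ p₀ p₁, Metric.ball x₀ d ⊆ X → x₁ ∈ X → x₁ ≠ x₀ →
      ‖x₁ - x₀‖ ≤ d * (1 / 2) ^ n / 48 → p₀ ∈ subgrad X u x₀ → p₁ ∈ subgrad X u x₁ →
      ‖p₁ - p₀‖ ≤ C * ‖x₁ - x₀‖ ^ (1 / (q - 1)) := by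
  have hul : LipschitzOnWith R u X :=
    lipschitzOnWith_of_subgrad hXo hu.1 fun x hx p hp => hR p (hu.2.1 x hx hp)
  obtain ⟨Γ, hΓ⟩ := exists_abs_le_of_lipschitzOnWith hXb hγ
  obtain ⟨D, hD⟩ := hXb.exists_norm_le
  have hD' : ∀ x ∈ X, ‖x‖ ≤ D.toNNReal := fun x hx => (hD x hx).trans (Real.le_coe_toNNReal D)
  set C₁ : ℝ := n * (Γ + (R ^ (q - 1) + D.toNNReal) * Kγ
    + n * (Γ * (R ^ (q - 1) + D.toNNReal)) / d) + Γ with hC₁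
  set C₂ : ℝ := 2 * (1 / 2) ^ q / q * lam * ((1 / 2) ^ n / 24) ^ q with hC₂
  have hq0 : 0 < q := by linarith
  have hq1 : 0 < q - 1 := by linarith
  have hC₁0 : 0 ≤ C₁ := by positivity
  have hC₂0 : 0 < C₂ := by positivity
  refine ⟨(C₁ / C₂) ^ (1 / (q - 1)), by positivity,
    fun x₀ x₁ p₀ p₁ hball hx₁ hne hr hp₀ hp₁ => ?_⟩
  rcases eq_or_ne p₁ p₀ with rfl | hp
  · rw [sub_self, norm_zero]
    positivity
  have hx₀ : x₀ ∈ X := hball (Metric.mem_ball_self hd)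
  have hP : (1 / 2 : ℝ) • (p₀ + p₁) ∈ closure Y := by
    rw [smul_add]
    exact hYc.closure (hu.2.1 x₀ hx₀ hp₀) (hu.2.1 x₁ hx₁ hp₁) (by norm_num) (by norm_num)
      (by norm_num)
  have hr0 : 0 < ‖x₁ - x₀‖ := norm_pos_iff.2 (sub_ne_zero.2 hne)
  have hk0 : 0 < ‖p₁ - p₀‖ := norm_pos_iff.2 (sub_ne_zero.2 hp)
  have hkey := norm_subgrad_sub_rpow_le hXo hXb hX hq hγ hΓ hγlb hlam hD' hul hu.1 hx₁ hp₀ hp₁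
    (hR _ hP) (fun c => hmin _ (admissible_max_affine hXo hYc hu hP c)) hd hball hr0 le_rfl hr hp
  rw [← hC₁, mul_div_assoc (‖p₁ - p₀‖), Real.mul_rpow hk0.le (by positivity)] at hkey
  have hsplit : ‖p₁ - p₀‖ ^ q = ‖p₁ - p₀‖ ^ (q - 1) * ‖p₁ - p₀‖ := by
    rw [← Real.rpow_add_one hk0.ne', sub_add_cancel]
  have hpow : ‖p₁ - p₀‖ ^ (q - 1) ≤ C₁ / C₂ * ‖x₁ - x₀‖ := by
    rw [div_mul_eq_mul_div, le_div_iff₀ hC₂0]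
    refine le_of_mul_le_mul_right ?_ hk0
    rw [hsplit] at hkey
    linarith
  rw [← Real.mul_rpow (by positivity) hr0.le, one_div]
  exact (Real.le_rpow_inv_iff_of_pos hk0.le (by positivity) hq1).2 hpow

theorem hasGradientAt_of_subgrad_tendsto (hXo : IsOpen X) {u : EuclideanSpace ℝ (Fin n) → ℝ}
    (hu : ConvexOn ℝ X u) {x₀ p₀ : EuclideanSpace ℝ (Fin n)} (hx₀ : x₀ ∈ X)
    (hp₀ : p₀ ∈ subgrad X u x₀)
    (h : ∀ ε > 0, ∀ᶠ x in nhds x₀, x ≠ x₀ → ∀ p ∈ subgrad X u x, ‖p - p₀‖ ≤ ε) :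
    HasGradientAt u p₀ x₀ := by
  rw [hasGradientAt_iff_isLittleO, Asymptotics.isLittleO_iff]
  intro ε hε
  filter_upwards [h ε hε, hXo.mem_nhds hx₀] with x hx hxX
  rcases eq_or_ne x x₀ with rfl | hne
  · simp
  obtain ⟨p, hp⟩ := subgrad_nonempty hXo hu hxX
  have h1 := hp₀ x hxX
  have h2 := hp x₀ hx₀
  have h3 : ⟪p - p₀, x - x₀⟫ ≤ ε * ‖x - x₀‖ :=
    (real_inner_le_norm _ _).trans
      (mul_le_mul_of_nonneg_right (hx hne p hp) (norm_nonneg _))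
  rw [← neg_sub x x₀, inner_neg_right] at h2
  rw [inner_sub_left] at h3
  rw [Real.norm_of_nonneg (by linarith)]
  linarith

end Regularity

/-- **Interior `C^{1,1/(q-1)}` regularity for the Rochet–Choné model with `q`-power cost,
`q > 2`** (Theorem 4.1, case `q > 2`). -/
theorem rochetChone_regularity_q_gt_two {n : ℕ} (hn : 1 ≤ n)
    (X Y : Set (EuclideanSpace ℝ (Fin n)))
    (hXo : IsOpen X) (hXb : Bornology.IsBounded X)
    (hYo : IsOpen Y) (hYb : Bornology.IsBounded Y) (hYc : Convex ℝ Y)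
    (a₀ : ℝ) (y₀ : EuclideanSpace ℝ (Fin n)) (hy₀ : y₀ ∈ Y)
    (q : ℝ) (hq : 2 < q)
    (γ : EuclideanSpace ℝ (Fin n) → ℝ) (Kγ : NNReal) (hγlip : LipschitzOnWith Kγ γ X)
    (lam : ℝ) (hlam : 0 < lam) (hγlb : ∀ x ∈ X, lam ≤ γ x)
    (u : EuclideanSpace ℝ (Fin n) → ℝ) (hu : admissible X Y a₀ y₀ u)
    (hmin : ∀ v, admissible X Y a₀ y₀ v → rochetChone X γ q u ≤ rochetChone X γ q v) :
    (∀ x ∈ X, DifferentiableAt ℝ u x) ∧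
      ∀ K : Set (EuclideanSpace ℝ (Fin n)), K ⊆ X → IsCompact K →
        ∃ C : ℝ, ∀ x ∈ K, ∀ y ∈ K,
          ‖gradient u x - gradient u y‖ ≤ C * ‖x - y‖ ^ (1 / (q - 1)) := by
  have : Nonempty (Fin n) := ⟨⟨0, hn⟩⟩
  have hX : Xᶜ.Nonempty := by
    rw [Set.nonempty_compl]
    rintro rfl
    exact NormedSpace.unbounded_univ ℝ (EuclideanSpace ℝ (Fin n)) hXb
  obtain ⟨R', hR'⟩ := hYb.closure.exists_norm_le
  obtain ⟨R, hR⟩ : ∃ R : NNReal, ∀ p ∈ closure Y, ‖p‖ ≤ R :=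
    ⟨R'.toNNReal, fun p hp => (hR' p hp).trans (Real.le_coe_toNNReal R')⟩
  have hq1 : 0 < 1 / (q - 1) := one_div_pos.2 (by linarith)
  have hgrad : ∀ x ∈ X, ∀ p ∈ subgrad X u x, HasGradientAt u p x := by
    intro x hx p hp
    obtain ⟨d, hd, hball⟩ := Metric.isOpen_iff.1 hXo x hx
    obtain ⟨C, -, hC⟩ := exists_norm_subgrad_sub_le hXo hXb hX hYc hq hγlip hlam hγlb hu hmin hR hd
    refine hasGradientAt_of_subgrad_tendsto hXo hu.1 hx hp fun ε hε => ?_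
    have hlim : Filter.Tendsto (fun z => C * ‖z - x‖ ^ (1 / (q - 1))) (nhds x) (nhds 0) := by
      have hc : Continuous fun z => C * ‖z - x‖ ^ (1 / (q - 1)) :=
        continuous_const.mul ((by fun_prop : Continuous fun z => ‖z - x‖).rpow_const
          fun _ => Or.inr hq1.le)
      have hlim := hc.tendsto x
      rwa [sub_self, norm_zero, Real.zero_rpow hq1.ne', mul_zero] at hlim
    filter_upwards [hlim.eventually (gt_mem_nhds hε), hXo.mem_nhds hx,
      Metric.ball_mem_nhds x (by positivity : 0 < d * (1 / 2) ^ n / 48)]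
      with z hz hzX hzd hne p' hp'
    rw [mem_ball_iff_norm] at hzd
    exact (hC x z p p' hball hzX hne hzd.le hp hp').trans hz.le
  have hmem : ∀ x ∈ X, gradient u x ∈ subgrad X u x := fun x hx => by
    obtain ⟨p, hp⟩ := subgrad_nonempty hXo hu.1 hx
    rwa [(hgrad x hx p hp).gradient]
  refine ⟨fun x hx => (hgrad x hx _ (hmem x hx)).differentiableAt, fun K hKX hK => ?_⟩
  obtain ⟨d, hd, hthick⟩ := hK.exists_thickening_subset_open hXo hKX
  obtain ⟨C, hC0, hC⟩ :=
    exists_norm_subgrad_sub_le hXo hXb hX hYc hq hγlip hlam hγlb hu hmin hR hd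
  set r := d * (1 / 2) ^ n / 48 with hr
  have hr0 : 0 < r := by positivity
  refine ⟨C + (R + R) / r ^ (1 / (q - 1)), fun x hx y hy => ?_⟩
  have hball : Metric.ball y d ⊆ X := (Metric.ball_subset_thickening hy d).trans hthick
  rcases eq_or_ne x y with rfl | hne
  · rw [sub_self, norm_zero]
    positivity
  rw [add_mul]
  rcases le_total ‖x - y‖ r with hxy | hxy
  · have := hC y x _ _ hball (hKX hx) hne hxy (hmem y (hKX hy)) (hmem x (hKX hx))
    have : 0 ≤ (R + R) / r ^ (1 / (q - 1)) * ‖x - y‖ ^ (1 / (q - 1)) := by positivity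
    linarith
  · have hR2 : ‖gradient u x - gradient u y‖ ≤ R + R := (norm_sub_le _ _).trans
      (add_le_add (hR _ (hu.2.1 x (hKX hx) (hmem x (hKX hx))))
        (hR _ (hu.2.1 y (hKX hy) (hmem y (hKX hy)))))
    have h1 : (R + R : ℝ) ≤ (R + R) / r ^ (1 / (q - 1)) * ‖x - y‖ ^ (1 / (q - 1)) := by
      rw [div_mul_eq_mul_div, le_div_iff₀ (by positivity)]
      gcongr
    have : 0 ≤ C * ‖x - y‖ ^ (1 / (q - 1)) := by positivity
    linarith
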